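/- Let Ω be an open set in ℂⁿ and f : Ω → ℂ a continuous map. Assume that on Ω \ f⁻¹(0) the differential inequality |∂̄f| ≤ K|f| holds for some constant K > 0, in the sense that ∂f/∂z̄_j = A_j f holds in the distribution sense on Ω \ f⁻¹(0) for j = 1,…,n, where the A_j are measurable functions with |A_j| ≤ K almost everywhere on Ω \ f⁻¹(0). Then f⁻¹(0) is a complex analytic set (complex variety) in Ω. -/

import Mathlib

open MeasureTheory Metric Set

noncomputable section

/-- The Wirtinger derivative `∂φ/∂z̄_j` of a function `φ : ℂⁿ → ℂ`,
computed from the real Fréchet derivative. -/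
def dbarCoord (n : ℕ) (φ : (Fin n → ℂ) → ℂ) (j : Fin n) (z : Fin n → ℂ) : ℂ :=
  (1 / 2 : ℂ) *
    (fderiv ℝ φ z (Pi.single j 1) + Complex.I * fderiv ℝ φ z (Pi.single j Complex.I))

/-- A test function on `U ⊆ ℂⁿ`: smooth, compactly supported, with support in `U`. -/
def IsTestC (n : ℕ) (U : Set (Fin n → ℂ)) (φ : (Fin n → ℂ) → ℂ) : Prop :=
  ContDiff ℝ (⊤ : ℕ∞) φ ∧ HasCompactSupport φ ∧ tsupport φ ⊆ U

/-- `∂f/∂z̄_j = A·f` holds in the distribution sense on the open set `U ⊆ ℂⁿ`: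
`∫ f ∂φ/∂z̄_j = −∫ A f φ` for every smooth `φ` compactly supported in `U`. -/
def DbarEqOnC (n : ℕ) (U : Set (Fin n → ℂ)) (f A : (Fin n → ℂ) → ℂ) (j : Fin n) : Prop :=
  ∀ φ : (Fin n → ℂ) → ℂ, IsTestC n U φ →
    ∫ z in U, f z * dbarCoord n φ j z = - ∫ z in U, A z * f z * φ z

/-- `V` is a complex variety (complex analytic set) in the open set `Ω ⊆ ℂⁿ`:
every point of `Ω` has an open neighborhood `U ⊆ Ω` and a family of holomorphic
functions on `U` whose common zero set is `V ∩ U`. -/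
def IsComplexVarietyIn (n : ℕ) (V Ω : Set (Fin n → ℂ)) : Prop :=
  ∀ z ∈ Ω, ∃ U : Set (Fin n → ℂ), IsOpen U ∧ z ∈ U ∧ U ⊆ Ω ∧
    ∃ (ι : Type) (g : ι → (Fin n → ℂ) → ℂ),
      (∀ i, DifferentiableOn ℂ (g i) U) ∧
      V ∩ U = {w ∈ U | ∀ i, g i w = 0}

/-! ### Wirtinger calculus -/

def wd {n : ℕ} (c : ℂ) (φ : (Fin n → ℂ) → ℂ) (j : Fin n) (z : Fin n → ℂ) : ℂ :=
  (1 / 2 : ℂ) *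
    (fderiv ℝ φ z (Pi.single j 1) + c * fderiv ℝ φ z (Pi.single j Complex.I))

lemma wd_I {n : ℕ} (φ : (Fin n → ℂ) → ℂ) (j : Fin n) : wd Complex.I φ j = dbarCoord n φ j := rfl

lemma wd_mul {n : ℕ} {c : ℂ} {φ ψ : (Fin n → ℂ) → ℂ} {j : Fin n} {z : Fin n → ℂ}
    (hφ : DifferentiableAt ℝ φ z) (hψ : DifferentiableAt ℝ ψ z) :
    wd c (fun w => φ w * ψ w) j z = wd c φ j z * ψ z + φ z * wd c ψ j z := by
  unfold wd
  rw [fderiv_fun_mul hφ hψ]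
  simp
  ring

lemma wd_sub {n : ℕ} {c : ℂ} {φ ψ : (Fin n → ℂ) → ℂ} {j : Fin n} {z : Fin n → ℂ}
    (hφ : DifferentiableAt ℝ φ z) (hψ : DifferentiableAt ℝ ψ z) :
    wd c (fun w => φ w - ψ w) j z = wd c φ j z - wd c ψ j z := by
  unfold wd
  rw [fderiv_fun_sub hφ hψ]
  simp
  ring

lemma wd_add {n : ℕ} {c : ℂ} {φ ψ : (Fin n → ℂ) → ℂ} {j : Fin n} {z : Fin n → ℂ}
    (hφ : DifferentiableAt ℝ φ z) (hψ : DifferentiableAt ℝ ψ z) :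
    wd c (fun w => φ w + ψ w) j z = wd c φ j z + wd c ψ j z := by
  unfold wd
  rw [fderiv_fun_add hφ hψ]
  simp
  ring

lemma wd_continuous {n : ℕ} {c : ℂ} {φ : (Fin n → ℂ) → ℂ} {j : Fin n}
    (hφ : ContDiff ℝ 1 φ) : Continuous (wd c φ j) := by
  unfold wd
  have := hφ.continuous_fderiv (by norm_num)
  fun_prop

lemma wd_contDiff {n : ℕ} {c : ℂ} {φ : (Fin n → ℂ) → ℂ} {j : Fin n}
    (hφ : ContDiff ℝ (⊤ : ℕ∞) φ) : ContDiff ℝ (⊤ : ℕ∞) (wd c φ j) := by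
  unfold wd
  have := hφ.fderiv_right (m := (⊤ : ℕ∞)) (by simp)
  fun_prop

lemma wd_support {n : ℕ} {c : ℂ} {φ : (Fin n → ℂ) → ℂ} {j : Fin n} {z : Fin n → ℂ}
    (hz : z ∉ tsupport φ) : wd c φ j z = 0 := by
  unfold wd
  rw [fderiv_of_notMem_tsupport ℝ hz]
  simp

lemma wd_hcs {n : ℕ} {c : ℂ} {φ : (Fin n → ℂ) → ℂ} {j : Fin n}
    (h : HasCompactSupport φ) : HasCompactSupport (wd c φ j) :=
  HasCompactSupport.intro h (fun _ hz => wd_support hz)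

lemma wd_congr {n : ℕ} {c : ℂ} {φ ψ : (Fin n → ℂ) → ℂ} {j : Fin n} {z : Fin n → ℂ}
    (h : φ =ᶠ[nhds z] ψ) : wd c φ j z = wd c ψ j z := by
  unfold wd
  rw [h.fderiv_eq]

lemma wd_comm {n : ℕ} {c c' : ℂ} {φ : (Fin n → ℂ) → ℂ} {j k : Fin n}
    (hφ : ContDiff ℝ 2 φ) (z : Fin n → ℂ) :
    wd c (wd c' φ k) j z = wd c' (wd c φ j) k z := by
  have hd : DifferentiableAt ℝ (fderiv ℝ φ) z :=
    (hφ.fderiv_right (m := 1) (by norm_num)).differentiable (by norm_num) z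
  have key : ∀ (c : ℂ) (k : Fin n) (w : Fin n → ℂ), fderiv ℝ (wd c φ k) z w =
      (1/2 : ℂ) * (fderiv ℝ (fderiv ℝ φ) z w (Pi.single k 1)
        + c * fderiv ℝ (fderiv ℝ φ) z w (Pi.single k Complex.I)) := by
    intro c k w
    have h1 : ∀ v : Fin n → ℂ, HasFDerivAt (fun x => fderiv ℝ φ x v)
        ((fderiv ℝ (fderiv ℝ φ) z).flip v) z := fun v => by
      simpa using hd.hasFDerivAt.clm_apply (hasFDerivAt_const v z)
    have h2 := ((h1 (Pi.single k 1)).add ((h1 (Pi.single k Complex.I)).const_mul c)).const_mul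
      (1/2 : ℂ)
    have : fderiv ℝ (wd c φ k) z = _ := h2.fderiv
    rw [this]
    simp
    ring
  have hs : IsSymmSndFDerivAt ℝ φ z := hφ.contDiffAt.isSymmSndFDerivAt (by simp)
  unfold wd at key ⊢
  simp only [key]
  rw [hs.eq (Pi.single j 1) (Pi.single k 1), hs.eq (Pi.single j 1) (Pi.single k Complex.I),
    hs.eq (Pi.single j Complex.I) (Pi.single k 1),
    hs.eq (Pi.single j Complex.I) (Pi.single k Complex.I)]
  ring

/-- Integration by parts. -/
lemma wd_ibp {n : ℕ} {c : ℂ} {f g : (Fin n → ℂ) → ℂ} {j : Fin n}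
    (hf : ContDiff ℝ 1 f) (hg : ContDiff ℝ 1 g) (hc : HasCompactSupport f) :
    ∫ z, f z * wd c g j z = - ∫ z, wd c f j z * g z := by
  have hf' := hf.continuous_fderiv (by norm_num)
  have hg' := hg.continuous_fderiv (by norm_num)
  have hfc := hf.continuous
  have hgc := hg.continuous
  have hc' : ∀ v, HasCompactSupport (fun z => fderiv ℝ f z v) := fun v => hc.fderiv_apply ℝ v
  have i1 : ∀ v, Integrable (fun z => f z * fderiv ℝ g z v) := fun v =>
    Continuous.integrable_of_hasCompactSupport (by fun_prop) hc.mul_right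
  have i2 : ∀ v, Integrable (fun z => fderiv ℝ f z v * g z) := fun v =>
    Continuous.integrable_of_hasCompactSupport (by fun_prop) (hc' v).mul_right
  have i3 : Integrable (fun z => f z * g z) :=
    Continuous.integrable_of_hasCompactSupport (by fun_prop) hc.mul_right
  have key : ∀ v, ∫ z, f z * fderiv ℝ g z v = - ∫ z, fderiv ℝ f z v * g z := fun v =>
    integral_mul_fderiv_eq_neg_fderiv_mul_of_integrable (i2 v) (i1 v) i3
      (fun x _ => hf.differentiable (by norm_num) x) (fun x _ => hg.differentiable (by norm_num) x)
  have e1 : ∀ z, f z * wd c g j z = (1/2) * (f z * fderiv ℝ g z (Pi.single j 1))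
      + (1/2) * c * (f z * fderiv ℝ g z (Pi.single j Complex.I)) := fun z => by
    unfold wd; ring
  have e2 : ∀ z, wd c f j z * g z = (1/2) * (fderiv ℝ f z (Pi.single j 1) * g z)
      + (1/2) * c * (fderiv ℝ f z (Pi.single j Complex.I) * g z) := fun z => by
    unfold wd; ring
  simp_rw [e1, e2]
  rw [integral_add ((i1 _).const_mul _) ((i1 _).const_mul _),
    integral_add ((i2 _).const_mul _) ((i2 _).const_mul _)]
  simp only [integral_const_mul, key]
  ring

lemma wd_green {n : ℕ} {c c' : ℂ} {φ G F : (Fin n → ℂ) → ℂ} {j k : Fin n}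
    (hφ : ContDiff ℝ 1 φ) (hc : HasCompactSupport φ) (hG : ContDiff ℝ 1 G)
    (hF : ContDiff ℝ (⊤ : ℕ∞) F) :
    ∫ z, φ z * (wd c G j z * wd c' F k z - wd c' G k z * wd c F j z)
      = - ∫ z, G z * (wd c φ j z * wd c' F k z - wd c' φ k z * wd c F j z) := by
  have hF1 : ∀ c k, ContDiff ℝ 1 (wd c F k) := fun c k => (wd_contDiff hF).of_le (by simp)
  have hp : ContDiff ℝ 1 (fun z => φ z * G z) := hφ.mul hG
  have hpc : HasCompactSupport (fun z => φ z * G z) := hc.mul_right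
  have h1 := wd_ibp (c := c) (j := j) hp (hF1 c' k) hpc
  have h2 := wd_ibp (c := c') (j := k) hp (hF1 c j) hpc
  have h3 : ∀ z, wd c (wd c' F k) j z = wd c' (wd c F j) k z :=
    wd_comm (contDiff_infty.1 hF 2)
  simp_rw [h3] at h1
  rw [h2] at h1
  have h4 := neg_injective h1
  have hd1 : ∀ c j z, wd c (fun z => φ z * G z) j z = wd c φ j z * G z + φ z * wd c G j z :=
    fun c j z => wd_mul (hφ.differentiable (by norm_num) z) (hG.differentiable (by norm_num) z)
  simp_rw [hd1] at h4
  have cφ := hφ.continuous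
  have cG := hG.continuous
  have c1 : ∀ c j, Continuous (wd c φ j) := fun c j => wd_continuous hφ
  have c2 : ∀ c j, Continuous (wd c G j) := fun c j => wd_continuous hG
  have c3 : ∀ c j, Continuous (wd c F j) := fun c j => (hF1 c j).continuous
  have I1 : Integrable (fun z => φ z * (wd c G j z * wd c' F k z - wd c' G k z * wd c F j z)) :=
    Continuous.integrable_of_hasCompactSupport
      (cφ.mul (((c2 _ _).mul (c3 _ _)).sub ((c2 _ _).mul (c3 _ _)))) hc.mul_right
  have I2 : Integrable (fun z => G z * (wd c φ j z * wd c' F k z - wd c' φ k z * wd c F j z)) := by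
    apply Continuous.integrable_of_hasCompactSupport
      (cG.mul (((c1 _ _).mul (c3 _ _)).sub ((c1 _ _).mul (c3 _ _))))
    exact ((wd_hcs hc).mul_right.sub (wd_hcs hc).mul_right).mul_left
  have I3 : ∀ c j c' k, Integrable (fun z => (wd c φ j z * G z + φ z * wd c G j z) * wd c' F k z) := by
    intro c j c' k
    apply Continuous.integrable_of_hasCompactSupport
      ((((c1 _ _).mul cG).add (cφ.mul (c2 _ _))).mul (c3 _ _))
    exact ((wd_hcs hc).mul_right.add hc.mul_right).mul_right
  rw [← add_eq_zero_iff_eq_neg, ← integral_add I1 I2]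
  rw [eq_comm, ← sub_eq_zero, ← integral_sub (I3 _ _ _ _) (I3 _ _ _ _)] at h4
  rw [← h4]
  congr 1
  ext z
  ring

/-! ### Radial cut-offs -/

def rad (s : ℝ → ℝ) (w : ℂ) : ℂ := ((s (Real.posLog ‖w‖) : ℝ) : ℂ)

lemma rad_eq_zero {s : ℝ → ℝ} (hs0 : ∀ x ≤ 0, s x = 0) {w : ℂ} (hw : ‖w‖ ≤ 1) : rad s w = 0 := by
  unfold rad
  rw [(Real.posLog_eq_zero_iff _).2 (by simpa using hw), hs0 0 le_rfl]
  simp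

lemma rad_eventually_zero {s : ℝ → ℝ} (hs0 : ∀ x ≤ 0, s x = 0) :
    rad s =ᶠ[nhds 0] fun _ => 0 := by
  filter_upwards [ball_mem_nhds (0:ℂ) one_pos] with w hw
  exact rad_eq_zero hs0 (by simpa using (mem_ball_zero_iff.1 hw).le)

lemma rad_eq_log {s : ℝ → ℝ} (hs0 : ∀ x ≤ 0, s x = 0) (w : ℂ) (hw : w ≠ 0) :
    rad s w = ((s (Real.log ‖w‖) : ℝ) : ℂ) := by
  rcases le_total 1 ‖w‖ with h | h
  · unfold rad
    rw [Real.posLog_eq_log (by simpa using h)]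
  · rw [rad_eq_zero hs0 h, hs0 _ (Real.log_nonpos (norm_nonneg _) h)]
    simp

lemma deriv_zero_of_nonpos {s : ℝ → ℝ} (hs : ContDiff ℝ 1 s) (hs0 : ∀ x ≤ 0, s x = 0)
    {x : ℝ} (hx : x ≤ 0) : deriv s x = 0 := by
  have h1 : HasDerivWithinAt s (deriv s x) (Iic x) x :=
    ((hs.differentiable (by norm_num)) x).hasDerivAt.hasDerivWithinAt
  have h2 : HasDerivWithinAt s 0 (Iic x) x :=
    (hasDerivWithinAt_const x (Iic x) (0:ℝ)).congr (fun y hy => hs0 y (le_trans hy hx)) (hs0 x hx)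
  exact (uniqueDiffWithinAt_Iic x).eq_deriv _ h1 h2

lemma rad_eventually_log {s : ℝ → ℝ} (hs0 : ∀ x ≤ 0, s x = 0) {w : ℂ} (hw : w ≠ 0) :
    rad s =ᶠ[nhds w] fun w => ((s (Real.log ‖w‖) : ℝ) : ℂ) := by
  filter_upwards [isOpen_ne.mem_nhds hw] with v hv
  exact rad_eq_log hs0 v hv

lemma rad_contDiff {s : ℝ → ℝ} (hs : ContDiff ℝ 1 s) (hs0 : ∀ x ≤ 0, s x = 0) :
    ContDiff ℝ 1 (rad s) := by
  rw [contDiff_iff_contDiffAt]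
  intro w
  by_cases hw : w = 0
  · subst hw
    exact contDiffAt_const.congr_of_eventuallyEq (rad_eventually_zero hs0)
  · refine ContDiffAt.congr_of_eventuallyEq ?_ (rad_eventually_log hs0 hw)
    refine Complex.ofRealCLM.contDiff.contDiffAt.comp w ?_
    refine hs.contDiffAt.comp w ?_
    exact (contDiffAt_norm ℝ hw).log (by simpa using hw)

lemma rad_div_contDiff {s : ℝ → ℝ} (hs : ContDiff ℝ 1 s) (hs0 : ∀ x ≤ 0, s x = 0) :
    ContDiff ℝ 1 (fun w => rad s w / w) := by
  rw [contDiff_iff_contDiffAt]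
  intro w
  by_cases hw : w = 0
  · subst hw
    refine (contDiffAt_const (c := (0:ℂ))).congr_of_eventuallyEq ?_
    filter_upwards [rad_eventually_zero hs0] with v hv
    simp [hv]
  · simp_rw [div_eq_mul_inv]
    exact (rad_contDiff hs hs0).contDiffAt.mul (contDiffAt_inv ℝ hw)

lemma rad_fderiv {s : ℝ → ℝ} (hs : ContDiff ℝ 1 s) (hs0 : ∀ x ≤ 0, s x = 0) (w h : ℂ) :
    fderiv ℝ (rad s) w h = ((deriv s (Real.posLog ‖w‖) * (h / w).re : ℝ) : ℂ) := by
  by_cases hw : w = 0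
  · subst hw
    rw [(rad_eventually_zero hs0).fderiv_eq]
    simp
  · rw [(rad_eventually_log hs0 hw).fderiv_eq]
    have h1 := (hasStrictFDerivAt_norm_sq w).hasFDerivAt
    have hn : ‖w‖ ^ 2 ≠ 0 := by simpa using hw
    have h2 := ((h1.log hn).const_mul (1/2 : ℝ))
    have h3 : HasFDerivAt (fun w : ℂ => Real.log ‖w‖)
        ((1/2 : ℝ) • ((‖w‖^2)⁻¹ • (2 • innerSL ℝ w))) w := by
      refine h2.congr_of_eventuallyEq ?_
      filter_upwards with v
      rw [Real.log_pow]; push_cast; ring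
    have h4 := ((hs.differentiable (by norm_num)) (Real.log ‖w‖)).hasDerivAt.comp_hasFDerivAt w h3
    have h5 := (Complex.ofRealCLM.hasFDerivAt).comp w h4
    have h6 : fderiv ℝ (fun w : ℂ => ((s (Real.log ‖w‖) : ℝ) : ℂ)) w = _ := h5.fderiv
    rw [h6]
    have hd : deriv s (Real.posLog ‖w‖) = deriv s (Real.log ‖w‖) := by
      rcases le_total 1 ‖w‖ with h | h
      · rw [Real.posLog_eq_log (by simpa using h)]
      · rw [(Real.posLog_eq_zero_iff _).2 (by simpa using h),
          deriv_zero_of_nonpos hs hs0 le_rfl,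
          deriv_zero_of_nonpos hs hs0 (Real.log_nonpos (norm_nonneg _) h)]
    rw [hd]
    have hr : (h / w).re = (‖w‖ ^ 2)⁻¹ * (h.re * w.re + h.im * w.im) := by
      rw [Complex.div_re, Complex.sq_norm]
      ring
    rw [hr]
    simp
    ring

lemma wd_rad {n : ℕ} {s : ℝ → ℝ} (hs : ContDiff ℝ 1 s) (hs0 : ∀ x ≤ 0, s x = 0) (c : ℂ)
    {F : (Fin n → ℂ) → ℂ} {z : Fin n → ℂ} (hF : DifferentiableAt ℝ F z) (j : Fin n) :
    wd c (fun z => rad s (F z)) j z = ((deriv s (Real.posLog ‖F z‖) : ℝ) : ℂ) / 2 *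
      (wd c F j z / F z + (starRingEnd ℂ) (wd ((starRingEnd ℂ) c) F j z / F z)) := by
  have h1 : fderiv ℝ (fun z => rad s (F z)) z = (fderiv ℝ (rad s) (F z)).comp (fderiv ℝ F z) :=
    fderiv_comp z ((rad_contDiff hs hs0).differentiable (by norm_num) _) hF
  unfold wd
  rw [h1]
  simp only [ContinuousLinearMap.comp_apply, rad_fderiv hs hs0]
  push_cast
  rw [Complex.re_eq_add_conj, Complex.re_eq_add_conj]
  simp only [map_mul, map_div₀, map_add, Complex.conj_conj, map_one]
  have h2 : (starRingEnd ℂ) 2 = 2 := Complex.conj_ofNat 2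
  rw [h2]
  ring

lemma wd_rad_div {n : ℕ} {s : ℝ → ℝ} (hs : ContDiff ℝ 1 s) (hs0 : ∀ x ≤ 0, s x = 0) (c : ℂ)
    {F : (Fin n → ℂ) → ℂ} {z : Fin n → ℂ} (hF : DifferentiableAt ℝ F z) (j : Fin n) :
    wd c (fun z => rad s (F z) / F z) j z = wd c (fun z => rad s (F z)) j z / F z
      - rad s (F z) * wd c F j z / (F z)^2 := by
  by_cases h0 : F z = 0
  · rw [h0]
    have : (fun z => rad s (F z) / F z) =ᶠ[nhds z] fun _ => 0 := by
      have := hF.continuousAt.tendsto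
      rw [h0] at this
      filter_upwards [this.eventually (rad_eventually_zero hs0)] with v hv
      simp [hv]
    rw [wd_congr this]
    simp [wd]
  · have hG : DifferentiableAt ℝ (fun z => rad s (F z) / F z) z :=
      ((rad_div_contDiff hs hs0).differentiable (by norm_num) _).comp z hF
    have h1 := wd_mul (c := c) (j := j) hG hF
    have h2 : (fun w => rad s (F w) / F w * F w) =ᶠ[nhds z] fun z => rad s (F z) := by
      filter_upwards [hF.continuousAt.eventually_ne h0] with v hv
      field_simp
    rw [wd_congr h2] at h1
    rw [h1]
    field_simp
    ring

/-! ### Caccioppoli type energy estimate -/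

lemma sq_max_hasDerivAt (x : ℝ) : HasDerivAt (fun x : ℝ => (max x 0)^2) (2 * max x 0) x := by
  rcases lt_trichotomy x 0 with h | h | h
  · rw [max_eq_right h.le]
    refine ((hasDerivAt_const x (0:ℝ)).congr_of_eventuallyEq ?_).congr_deriv (by simp)
    filter_upwards [Iio_mem_nhds h] with y hy
    simp [max_eq_right (le_of_lt (mem_Iio.1 hy))]
  · subst h
    rw [hasDerivAt_iff_isLittleO]
    simp only [max_self, sub_zero, mul_zero, smul_zero]
    have : (fun x : ℝ => (max x 0)^2 - 0^2) =O[nhds 0] fun x : ℝ => x^2 := by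
      refine Asymptotics.IsBigO.of_bound 1 (Filter.Eventually.of_forall fun x => ?_)
      simp only [Real.norm_eq_abs, one_mul]
      rw [abs_of_nonneg (a := x^2) (by positivity), zero_pow (by norm_num), sub_zero,
        abs_of_nonneg (by positivity)]
      rcases le_total x 0 with h | h
      · rw [max_eq_right h]; nlinarith [sq_nonneg x]
      · rw [max_eq_left h]
    refine this.trans_isLittleO ?_
    simpa using (Asymptotics.isLittleO_pow_id (𝕜 := ℝ) (n := 2) (by norm_num))
  · rw [max_eq_left h.le]
    refine ((hasDerivAt_pow 2 x).congr_of_eventuallyEq ?_).congr_deriv (by simp)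
    filter_upwards [Ioi_mem_nhds h] with y hy
    simp [max_eq_left (le_of_lt (mem_Ioi.1 hy))]

lemma sq_max_contDiff : ContDiff ℝ 1 (fun x : ℝ => (max x 0)^2) := by
  rw [contDiff_one_iff_deriv]
  refine ⟨fun x => (sq_max_hasDerivAt x).differentiableAt, ?_⟩
  have : deriv (fun x : ℝ => (max x 0)^2) = fun x => 2 * max x 0 :=
    funext fun x => (sq_max_hasDerivAt x).deriv
  rw [this]
  fun_prop

lemma posLog_norm_div_sq (w : ℂ) :
    Real.posLog ‖w‖ / ‖w‖^2 = Real.posLog ‖w‖ / (max 1 ‖w‖)^2 := by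
  rcases le_total 1 ‖w‖ with h | h
  · rw [max_eq_right h]
  · rw [(Real.posLog_eq_zero_iff _).2 (by simpa using h)]; simp

lemma continuous_posLog_div {n : ℕ} {F q : (Fin n → ℂ) → ℂ} (hF : Continuous F)
    (hq : Continuous q) :
    Continuous fun z => Real.posLog ‖F z‖ * ‖q z / F z‖^2 := by
  have : (fun z => Real.posLog ‖F z‖ * ‖q z / F z‖^2) =
      fun z => Real.posLog ‖F z‖ / (max 1 ‖F z‖)^2 * ‖q z‖^2 := by
    ext z
    rw [← posLog_norm_div_sq, norm_div, div_pow]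
    ring
  rw [this]
  refine Continuous.mul (Continuous.div ?_ (by fun_prop) ?_) (by fun_prop)
  · exact Real.continuous_posLog.comp hF.norm
  · intro z
    positivity

lemma energy {n : ℕ} (ψ : (Fin n → ℂ) → ℝ) (hψ : ContDiff ℝ 1 ψ)
    (hc : HasCompactSupport ψ) (K : ℝ) (hK : 0 ≤ K) (j : Fin n) :
    ∃ C : ℝ, 0 ≤ C ∧ ∀ (F : (Fin n → ℂ) → ℂ) (L : ℝ), ContDiff ℝ (⊤ : ℕ∞) F → 1 ≤ L →
      (∀ z ∈ tsupport ψ, 1 ≤ ‖F z‖ → ‖wd Complex.I F j z‖ ≤ K * ‖F z‖) →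
      (∀ z ∈ tsupport ψ, Real.posLog ‖F z‖ ≤ L) →
      ∫ z, ψ z ^ 2 * (Real.posLog ‖F z‖ * ‖wd (-Complex.I) F j z / F z‖^2) ≤ C * L^3 := by
  set ψc : (Fin n → ℂ) → ℂ := fun z => (ψ z : ℂ) with hψc
  have hψc1 : ContDiff ℝ 1 ψc := Complex.ofRealCLM.contDiff.comp hψ
  have hcc : HasCompactSupport ψc := hc.comp_left (g := fun x : ℝ => (x : ℂ)) (by simp)
  set D : (Fin n → ℂ) → ℝ := fun z => 2 * ‖wd Complex.I ψc j z‖^2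
    + 2 * |ψ z| * ‖wd (-Complex.I) ψc j z‖ * K with hD
  have cψ := hψ.continuous
  have cw : ∀ c, Continuous (wd c ψc j) := fun c => wd_continuous hψc1
  have hD0 : ∀ z, 0 ≤ D z := fun z => by simp only [hD]; positivity
  have iD : Integrable D := by
    refine Continuous.integrable_of_hasCompactSupport ?_ ?_
    · have := cw Complex.I
      have := cw (-Complex.I)
      fun_prop
    · refine HasCompactSupport.intro hcc fun z hz => ?_
      simp [hD, wd_support hz]
  have iψ : Integrable (fun z => K^2 * ψ z^2) := by
    refine Continuous.integrable_of_hasCompactSupport (by fun_prop) ?_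
    refine HasCompactSupport.intro hc fun z hz => ?_
    simp [image_eq_zero_of_notMem_tsupport hz]
  refine ⟨2 * (∫ z, D z + K^2 * ψ z^2), ?_, ?_⟩
  · refine mul_nonneg (by norm_num) (integral_nonneg fun z => ?_)
    have := hD0 z
    positivity
  intro F L hF hL hA hX
  set s : ℝ → ℝ := fun x => (max x 0)^2 with hs
  have hs0 : ∀ x ≤ 0, s x = 0 := fun x hx => by simp [hs, max_eq_right hx]
  have hsd : ∀ x, 0 ≤ x → deriv s x = 2 * x := fun x hx => by
    rw [(sq_max_hasDerivAt x).deriv, max_eq_left hx]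
  have hF1 : ContDiff ℝ 1 F := hF.of_le (by simp)
  have hFd : Differentiable ℝ F := hF1.differentiable (by norm_num)
  have hG : ContDiff ℝ 1 (fun z => rad s (F z) / F z) :=
    (rad_div_contDiff sq_max_contDiff hs0).comp hF1
  have green := wd_green (c := Complex.I) (c' := -Complex.I) (j := j) (k := j)
    (hψc1.mul hψc1) hcc.mul_right hG hF
  set X : (Fin n → ℂ) → ℝ := fun z => Real.posLog ‖F z‖ with hXd
  have hX0 : ∀ z, 0 ≤ X z := fun z => Real.posLog_nonneg
  set a : (Fin n → ℂ) → ℝ := fun z => ‖wd Complex.I F j z / F z‖ with ha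
  set b : (Fin n → ℂ) → ℝ := fun z => ‖wd (-Complex.I) F j z / F z‖ with hb
  have cF : ∀ c, Continuous (wd c F j) := fun c => wd_continuous hF1
  have icomp : ∀ q : (Fin n → ℂ) → ℂ, Continuous q →
      Integrable (fun z => ψ z^2 * (X z * ‖q z / F z‖^2)) := fun q hq => by
    refine Continuous.integrable_of_hasCompactSupport
      ((cψ.pow 2).mul (continuous_posLog_div hF.continuous hq)) ?_
    refine HasCompactSupport.intro hc fun z hz => ?_
    simp [image_eq_zero_of_notMem_tsupport hz]
  have ib : Integrable (fun z => ψ z^2 * (X z * b z^2)) := icomp _ (cF _)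
  have ia : Integrable (fun z => ψ z^2 * (X z * a z^2)) := icomp _ (cF _)
  have hlhs : ∀ z, ψc z * ψc z * (wd Complex.I (fun z => rad s (F z) / F z) j z
      * wd (-Complex.I) F j z - wd (-Complex.I) (fun z => rad s (F z) / F z) j z
      * wd Complex.I F j z) = ((ψ z^2 * (X z * b z^2) - ψ z^2 * (X z * a z^2) : ℝ) : ℂ) := by
    intro z
    rw [wd_rad_div sq_max_contDiff hs0 _ (hFd z), wd_rad_div sq_max_contDiff hs0 _ (hFd z),
      wd_rad sq_max_contDiff hs0 _ (hFd z), wd_rad sq_max_contDiff hs0 _ (hFd z), ← hs]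
    rw [hsd _ Real.posLog_nonneg]
    simp only [map_neg, Complex.conj_I, neg_neg]
    push_cast
    simp only [ha, hb, ← Complex.ofReal_pow, Complex.sq_norm]
    simp only [Complex.normSq_eq_conj_mul_self, hψc, hXd]
    push_cast
    ring
  simp_rw [hlhs] at green
  rw [integral_complex_ofReal] at green
  have key : |∫ z, (ψ z^2 * (X z * b z^2) - ψ z^2 * (X z * a z^2))| ≤
      ∫ z, ((1/2) * (ψ z^2 * (X z * b z^2)) + L^3 * D z) := by
    rw [← Real.norm_eq_abs, ← Complex.norm_real, green, norm_neg]
    refine norm_integral_le_of_norm_le ((ib.const_mul _).add (iD.const_mul _))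
      (Filter.Eventually.of_forall fun z => ?_)
    have hψd := hψc1.differentiable (by norm_num) z
    simp only [wd_mul hψd hψd]
    have e1 : rad s (F z) / F z * ((wd Complex.I ψc j z * ψc z + ψc z * wd Complex.I ψc j z)
        * wd (-Complex.I) F j z - (wd (-Complex.I) ψc j z * ψc z + ψc z * wd (-Complex.I) ψc j z)
        * wd Complex.I F j z) = (X z : ℂ)^2 * (2 * ψc z * wd Complex.I ψc j z *
          (wd (-Complex.I) F j z / F z) - 2 * ψc z * wd (-Complex.I) ψc j z *
          (wd Complex.I F j z / F z)) := by
      have : rad s (F z) = (X z : ℂ)^2 := by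
        simp only [rad, hs, hXd]
        rw [max_eq_left Real.posLog_nonneg]
        push_cast; rfl
      rw [this]
      ring
    rw [e1]
    by_cases hz : z ∈ tsupport ψ
    swap
    · have h0 : ψc z = 0 := by simp [hψc, image_eq_zero_of_notMem_tsupport hz]
      simp only [h0, mul_zero, zero_mul, sub_zero, norm_zero]
      have := hD0 z
      have := hX0 z
      positivity
    have n1 : ‖(X z : ℂ)^2 * (2 * ψc z * wd Complex.I ψc j z *
          (wd (-Complex.I) F j z / F z) - 2 * ψc z * wd (-Complex.I) ψc j z *
          (wd Complex.I F j z / F z))‖ ≤ X z^2 * (2 * |ψ z| * ‖wd Complex.I ψc j z‖ * b z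
            + 2 * |ψ z| * ‖wd (-Complex.I) ψc j z‖ * a z) := by
      rw [norm_mul]
      have : ‖(X z : ℂ)^2‖ = X z^2 := by simp
      rw [this]
      refine mul_le_mul_of_nonneg_left ((norm_sub_le _ _).trans (le_of_eq ?_)) (by positivity)
      simp only [norm_mul, hψc, Complex.norm_real, Real.norm_eq_abs, ha, hb]
      simp
    refine n1.trans ?_
    set P1 := ‖wd Complex.I ψc j z‖
    set P2 := ‖wd (-Complex.I) ψc j z‖ with hP2
    have hXz := hX z hz
    have hx0 := hX0 z
    have hXL : X z ^ 3 ≤ L^3 := pow_le_pow_left₀ hx0 hXz 3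
    have hXL2 : X z ^ 2 ≤ L^3 := (pow_le_pow_left₀ hx0 hXz 2).trans (pow_le_pow_right₀ hL (by norm_num))
    have hXa : X z^2 * a z ≤ L^3 * K := by
      by_cases h1 : 1 ≤ ‖F z‖
      · have : a z ≤ K := by
          simp only [ha, norm_div]
          rw [div_le_iff₀ (by linarith)]
          exact hA z hz h1
        have ha0 : 0 ≤ a z := norm_nonneg _
        exact mul_le_mul hXL2 this ha0 (by positivity)
      · have : X z = 0 := (Real.posLog_eq_zero_iff _).2 (by simpa using (not_le.1 h1).le)
        rw [this]
        simp only [ne_eq, OfNat.ofNat_ne_zero, not_false_eq_true, zero_pow, zero_mul]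
        positivity
    have h1 : X z^2 * (2 * |ψ z| * P1 * b z) ≤ 1/2 * (ψ z^2 * (X z * b z^2)) + 2 * X z^3 * P1^2 := by
      have := mul_nonneg hx0 (sq_nonneg (|ψ z| * b z - 2 * X z * P1))
      have e : |ψ z|^2 = ψ z^2 := sq_abs _
      have : X z * (|ψ z|^2 * b z^2 - 4 * |ψ z| * b z * X z * P1 + 4 * X z^2 * P1^2) ≥ 0 := by
        nlinarith
      rw [e] at this
      nlinarith
    have h2 : X z^2 * (2 * |ψ z| * P2 * a z) ≤ L^3 * (2 * |ψ z| * P2 * K) := by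
      have h0 : 0 ≤ 2 * |ψ z| * P2 := by positivity
      nlinarith
    have h3 : 2 * X z^3 * P1^2 ≤ L^3 * (2 * P1^2) := by nlinarith [sq_nonneg P1]
    simp only [hD]
    calc _ = X z^2 * (2 * |ψ z| * P1 * b z) + X z^2 * (2 * |ψ z| * P2 * a z) := by ring
      _ ≤ _ := by
        rw [mul_add]
        linarith
  have ha' : ∫ z, ψ z^2 * (X z * a z^2) ≤ ∫ z, L^3 * (K^2 * ψ z^2) := by
    refine integral_mono ia (iψ.const_mul _) fun z => ?_
    by_cases hz : z ∈ tsupport ψ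
    swap
    · simp [image_eq_zero_of_notMem_tsupport hz]
    have hx0 := hX0 z
    by_cases h1 : 1 ≤ ‖F z‖
    · have h2 : a z ≤ K := by
        simp only [ha, norm_div]
        rw [div_le_iff₀ (by linarith)]
        exact hA z hz h1
      have ha0 : 0 ≤ a z := norm_nonneg _
      have h3 : a z^2 ≤ K^2 := pow_le_pow_left₀ ha0 h2 2
      have h4 : X z ≤ L^3 := (hX z hz).trans (by nlinarith [sq_nonneg (L-1), sq_nonneg L])
      have h5 : X z * a z^2 ≤ L^3 * K^2 := mul_le_mul h4 h3 (by positivity) (by positivity)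
      have := mul_le_mul_of_nonneg_left h5 (sq_nonneg (ψ z))
      simp only
      linarith
    · have : X z = 0 := (Real.posLog_eq_zero_iff _).2 (by simpa using (not_le.1 h1).le)
      simp only [this, zero_mul, mul_zero]
      positivity
  rw [integral_sub ib ia, integral_add (ib.const_mul _) (iD.const_mul _)] at key
  simp only [integral_const_mul] at key ha'
  have e2 : ∫ z, D z + K^2 * ψ z^2 = (∫ z, D z) + K^2 * ∫ z, ψ z^2 := by
    rw [integral_add iD iψ, integral_const_mul]
  rw [e2]
  have := le_abs_self ((∫ z, ψ z^2 * (X z * b z^2)) - ∫ z, ψ z^2 * (X z * a z^2))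
  nlinarith

/-! ### Logarithmic cut-off -/

def kap (L x : ℝ) : ℝ := Real.smoothTransition (4 * x / L - 1)

lemma kap_contDiff (L : ℝ) : ContDiff ℝ 1 (kap L) := by
  unfold kap
  exact (Real.smoothTransition.contDiff (n := 1)).comp (by fun_prop)

lemma kap_zero {L : ℝ} (hL : 0 < L) : ∀ x ≤ 0, kap L x = 0 := fun x hx => by
  unfold kap
  apply Real.smoothTransition.zero_of_nonpos
  have : 4 * x / L ≤ 0 := div_nonpos_of_nonpos_of_nonneg (by linarith) hL.le
  linarith

lemma kap_one {L x : ℝ} (hL : 0 < L) (hx : L / 2 ≤ x) : kap L x = 1 := by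
  unfold kap
  apply Real.smoothTransition.one_of_one_le
  have : 2 ≤ 4 * x / L := by rw [le_div_iff₀ hL]; linarith
  linarith

lemma kap_nonneg (L x : ℝ) : 0 ≤ kap L x := Real.smoothTransition.nonneg _
lemma kap_le_one (L x : ℝ) : kap L x ≤ 1 := Real.smoothTransition.le_one _

lemma smoothTransition_deriv_bound : ∃ C : ℝ, 0 ≤ C ∧
    (∀ x, |deriv Real.smoothTransition x| ≤ C) ∧
    ∀ x, x ∉ Icc (0:ℝ) 1 → deriv Real.smoothTransition x = 0 := by
  have h0 : ∀ x, x ∉ Icc (0:ℝ) 1 → deriv Real.smoothTransition x = 0 := by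
    intro x hx
    rw [mem_Icc, not_and_or, not_le, not_le] at hx
    rcases hx with h | h
    · have : Real.smoothTransition =ᶠ[nhds x] fun _ => 0 := by
        filter_upwards [Iio_mem_nhds h] with y hy
        exact Real.smoothTransition.zero_of_nonpos (mem_Iio.1 hy).le
      rw [this.deriv_eq]; simp
    · have : Real.smoothTransition =ᶠ[nhds x] fun _ => 1 := by
        filter_upwards [Ioi_mem_nhds h] with y hy
        exact Real.smoothTransition.one_of_one_le (mem_Ioi.1 hy).le
      rw [this.deriv_eq]; simp
  have hc : Continuous (deriv Real.smoothTransition) :=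
    (Real.smoothTransition.contDiff (n := 1)).continuous_deriv (by norm_num)
  obtain ⟨C, hC⟩ := isCompact_Icc.exists_bound_of_continuousOn (s := Icc (0:ℝ) 1) hc.continuousOn
  refine ⟨max C 0, le_max_right _ _, fun x => ?_, h0⟩
  by_cases hx : x ∈ Icc (0:ℝ) 1
  · exact (hC x hx).trans (le_max_left _ _)
  · rw [h0 x hx]; simp

lemma kap_deriv : ∃ C : ℝ, 0 ≤ C ∧ ∀ L x : ℝ, 0 < L →
    (|deriv (kap L) x| ≤ C / L) ∧ (x ∉ Icc (L/4) (L/2) → deriv (kap L) x = 0) := by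
  obtain ⟨C, hC, h1, h2⟩ := smoothTransition_deriv_bound
  refine ⟨4 * C, by positivity, fun L x hL => ?_⟩
  have hd : deriv (kap L) x = deriv Real.smoothTransition (4 * x / L - 1) * (4 / L) := by
    have e : HasDerivAt (fun x : ℝ => 4 * x / L - 1) (4 / L) x := by
      simpa using (((hasDerivAt_id x).const_mul 4).div_const L).sub_const 1
    exact (((Real.smoothTransition.contDiff (n := 1)).differentiable (by norm_num)
      (4 * x / L - 1)).hasDerivAt.comp x e).deriv
  rw [hd]
  constructor
  · rw [abs_mul, abs_of_nonneg (a := 4 / L) (by positivity)]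
    calc _ ≤ C * (4 / L) := mul_le_mul_of_nonneg_right (h1 _) (by positivity)
      _ = _ := by ring
  · intro hx
    rw [h2, zero_mul]
    intro h
    apply hx
    rw [mem_Icc] at h ⊢
    have e1 : 4 * x / L = 4 * (x / L) := by ring
    rw [e1] at h
    constructor
    · have : 1/4 ≤ x / L := by linarith
      rw [le_div_iff₀ hL] at this; linarith
    · have : x / L ≤ 1/2 := by linarith
      rw [div_le_iff₀ hL] at this; linarith

def shell {n : ℕ} (S : Set (Fin n → ℂ)) (F : (Fin n → ℂ) → ℂ) (L : ℝ) : Set (Fin n → ℂ) :=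
  {z ∈ S | Real.posLog ‖F z‖ ∈ Icc (L/4) (L/2)}

lemma shell_est {n : ℕ} (ψ : (Fin n → ℂ) → ℝ) (hψ : ContDiff ℝ 1 ψ)
    (hc : HasCompactSupport ψ) (hψ1 : ∀ z, |ψ z| ≤ 1) (K : ℝ) (hK : 0 ≤ K) (j : Fin n) :
    ∃ C : ℝ, 0 ≤ C ∧ ∀ (F : (Fin n → ℂ) → ℂ) (L : ℝ), ContDiff ℝ (⊤ : ℕ∞) F → 1 ≤ L →
      (∀ z ∈ tsupport ψ, 1 ≤ ‖F z‖ → ‖wd Complex.I F j z‖ ≤ K * ‖F z‖) →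
      (∀ z ∈ tsupport ψ, Real.posLog ‖F z‖ ≤ L) → ∀ η : ℝ, 0 < η → η ≤ 1 →
      ∃ D : (Fin n → ℂ) → ℝ, Integrable D ∧ (∀ z, 0 ≤ D z) ∧
      (∀ z, ψ z ^ 2 * (|deriv (kap L) (Real.posLog ‖F z‖)| *
        (1 + ‖wd (-Complex.I) F j z / F z‖)) ≤ D z) ∧
      ∫ z, D z ≤ C * (η + volume.real (shell (tsupport ψ) F L) / η) := by
  obtain ⟨C1, hC1, hE⟩ := energy ψ hψ hc K hK j
  obtain ⟨C2, hC2, hk⟩ := kap_deriv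
  refine ⟨C2 * (4 * C1) + 2 * C2, by positivity, fun F L hF hL hA hX η hη hη1 => ?_⟩
  have hL0 : 0 < L := by linarith
  set X : (Fin n → ℂ) → ℝ := fun z => Real.posLog ‖F z‖ with hXd
  have hX0 : ∀ z, 0 ≤ X z := fun z => Real.posLog_nonneg
  set b : (Fin n → ℂ) → ℝ := fun z => ‖wd (-Complex.I) F j z / F z‖ with hb
  have hF1 : ContDiff ℝ 1 F := hF.of_le (by simp)
  have cF : ∀ c, Continuous (wd c F j) := fun c => wd_continuous hF1
  have cX : Continuous X := Real.continuous_posLog.comp hF.continuous.norm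
  have ib : Integrable (fun z => ψ z^2 * (X z * b z^2)) := by
    refine Continuous.integrable_of_hasCompactSupport
      ((hψ.continuous.pow 2).mul (continuous_posLog_div hF.continuous (cF _))) ?_
    refine HasCompactSupport.intro hc fun z hz => ?_
    simp [image_eq_zero_of_notMem_tsupport hz]
  have hSc : IsClosed (shell (tsupport ψ) F L) :=
    (isClosed_tsupport ψ).inter (isClosed_Icc.preimage cX)
  have hSm : MeasurableSet (shell (tsupport ψ) F L) := hSc.measurableSet
  have hSf : volume (shell (tsupport ψ) F L) ≠ ⊤ :=
    ((measure_mono (fun z hz => hz.1)).trans_lt (IsCompact.measure_lt_top hc)).ne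
  have iS : Integrable ((shell (tsupport ψ) F L).indicator fun _ => (1:ℝ)) :=
    (integrable_indicator_iff hSm).2 (integrableOn_const (by simpa using hSf))
  refine ⟨fun z => (C2 * (4 * η / L^3)) * (ψ z^2 * (X z * b z^2)) + (2 * C2 / η) *
    (shell (tsupport ψ) F L).indicator (fun _ => (1:ℝ)) z,
    (ib.const_mul _).add (iS.const_mul _), ?_, ?_, ?_⟩
  · intro z
    have := hX0 z
    have : 0 ≤ (shell (tsupport ψ) F L).indicator (fun _ => (1:ℝ)) z :=
      indicator_nonneg (fun _ _ => zero_le_one) z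
    positivity
  · intro z
    change ψ z^2 * (|deriv (kap L) (X z)| * (1 + b z)) ≤ (C2 * (4 * η / L^3)) * (ψ z^2 * (X z * b z^2))
      + (2 * C2 / η) * (shell (tsupport ψ) F L).indicator (fun _ => (1:ℝ)) z
    have hx := hX0 z
    by_cases hz : z ∈ shell (tsupport ψ) F L
    · rw [indicator_of_mem hz]
      have h1 := (hk L (X z) hL0).1
      have h2 : L / 4 ≤ X z := hz.2.1
      have hb0 : 0 ≤ b z := norm_nonneg _
      have hp : ψ z^2 ≤ 1 := by rw [← sq_abs]; exact pow_le_one₀ (abs_nonneg _) (hψ1 z)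
      have h3 : (1 + b z) / L ≤ 4 * η / L^3 * (X z * b z^2) + 2 / η := by
        have e1 : b z / L ≤ η * (b z / L)^2 + 1/η := by
          have : 0 ≤ (η * (b z/L) - 1)^2 + η * (b z / L) := by positivity
          have e : η * (b z / L)^2 + 1/η - b z / L
            = ((η * (b z/L) - 1)^2 + η * (b z / L)) / η := by field_simp; ring
          have : 0 ≤ ((η * (b z/L) - 1)^2 + η * (b z / L)) / η := by positivity
          linarith
        have e2 : 1 / L ≤ 1 / η := by
          apply one_div_le_one_div_of_le hη; linarith
        have e3 : η * (b z / L)^2 ≤ 4 * η / L^3 * (X z * b z^2) := by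
          have : 4 * η / L^3 * (X z * b z^2) = η * (b z/L)^2 * (4 * X z / L) := by
            field_simp
          rw [this]
          refine le_mul_of_one_le_right (by positivity) ?_
          rw [le_div_iff₀ hL0]; linarith
        calc _ = 1 / L + b z / L := by ring
          _ ≤ _ := by
            have : 2 / η = 1/η + 1/η := by ring
            linarith
      calc ψ z^2 * (|deriv (kap L) (X z)| * (1 + b z))
          ≤ ψ z^2 * (C2 / L * (1 + b z)) := by gcongr
        _ = ψ z^2 * C2 * ((1 + b z) / L) := by ring
        _ ≤ ψ z^2 * C2 * (4 * η / L^3 * (X z * b z^2) + 2 / η) := by gcongr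
        _ = (C2 * (4 * η / L^3)) * (ψ z^2 * (X z * b z^2)) + ψ z^2 * (2 * C2 / η) := by ring
        _ ≤ _ := by
          have : ψ z^2 * (2 * C2 / η) ≤ 1 * (2 * C2 / η) :=
            mul_le_mul_of_nonneg_right hp (by positivity)
          linarith
    · rw [indicator_of_notMem hz]
      have : ψ z^2 * (|deriv (kap L) (X z)| * (1 + b z)) = 0 := by
        by_cases hz' : z ∈ tsupport ψ
        · have : X z ∉ Icc (L/4) (L/2) := fun h => hz ⟨hz', h⟩
          rw [(hk L (X z) hL0).2 this]; simp
        · simp [image_eq_zero_of_notMem_tsupport hz']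
      rw [this]
      positivity
  · have hEn := hE F L hF hL hA hX
    rw [integral_add (ib.const_mul _) (iS.const_mul _), integral_const_mul, integral_const_mul,
      integral_indicator_const _ hSm]
    simp only [smul_eq_mul, mul_one]
    set m := volume.real (shell (tsupport ψ) F L)
    have hm : 0 ≤ m := measureReal_nonneg
    have h1 : (C2 * (4 * η / L^3)) * (∫ z, ψ z^2 * (X z * b z^2)) ≤
        (C2 * (4 * η / L^3)) * (C1 * L^3) := by
      refine mul_le_mul_of_nonneg_left hEn (by positivity)
    have h2 : (C2 * (4 * η / L^3)) * (C1 * L^3) = C2 * (4 * C1) * η := by field_simp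
    have h3 : 0 ≤ 2 * C2 * η := by positivity
    have h4 : 0 ≤ C2 * (4 * C1) * (m / η) := by positivity
    have h5 : 2 * C2 / η * m = 2 * C2 * (m / η) := by ring
    rw [h5]
    linarith

/-- First cut-off estimate. -/
lemma cut_one {n : ℕ} (φ : (Fin n → ℂ) → ℂ) (hφ : ContDiff ℝ 1 φ)
    (ψ : (Fin n → ℂ) → ℝ) (hψ : ContDiff ℝ 1 ψ)
    (hc : HasCompactSupport ψ) (hψ1 : ∀ z, |ψ z| ≤ 1) (hφψ : ∀ z ∈ tsupport φ, ψ z = 1)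
    (hcφ : HasCompactSupport φ)
    (K : ℝ) (hK : 0 ≤ K) (M : ℝ) (hM : 0 ≤ M) (j : Fin n) :
    ∃ C : ℝ, 0 ≤ C ∧ ∀ (F : (Fin n → ℂ) → ℂ) (L e : ℝ), ContDiff ℝ (⊤ : ℕ∞) F → 1 ≤ L →
      (∀ z ∈ tsupport ψ, 1 ≤ ‖F z‖ → ‖wd Complex.I F j z‖ ≤ K * ‖F z‖) →
      (∀ z ∈ tsupport ψ, Real.posLog ‖F z‖ ≤ L) →
      (∀ z ∈ tsupport ψ, ‖e * F z‖ ≤ M) → ∀ η : ℝ, 0 < η → η ≤ 1 →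
      ‖∫ z, rad (kap L) (F z) * (e * F z * wd Complex.I φ j z + e * wd Complex.I F j z * φ z)‖
        ≤ C * (η + volume.real (shell (tsupport ψ) F L) / η) := by
  obtain ⟨C1, hC1, hS⟩ := shell_est ψ hψ hc hψ1 K hK j
  obtain ⟨Mφ, hMφ⟩ := hφ.continuous.bounded_above_of_compact_support hcφ
  have hMφ0 : 0 ≤ Mφ := (norm_nonneg _).trans (hMφ 0)
  refine ⟨(Mφ * M * (K + 1)) * C1, by positivity, fun F L e hF hL hA hX he η hη hη1 => ?_⟩
  have hL0 : 0 < L := by linarith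
  obtain ⟨D, iD, hD0, hD, hDi⟩ := hS F L hF hL hA hX η hη hη1
  have hF1 : ContDiff ℝ 1 F := hF.of_le (by simp)
  have hFd : Differentiable ℝ F := hF1.differentiable (by norm_num)
  have heF : ContDiff ℝ 1 (fun z => (e:ℂ) * F z) := contDiff_const.mul hF1
  have hp : ContDiff ℝ 1 (fun z => φ z * (e * F z)) := hφ.mul heF
  have hr : ContDiff ℝ 1 (fun z => rad (kap L) (F z)) :=
    (rad_contDiff (kap_contDiff L) (kap_zero hL0)).comp hF1
  have h1 := wd_ibp (c := Complex.I) (j := j) hp hr hcφ.mul_right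
  have h2 : ∀ z, rad (kap L) (F z) * (e * F z * wd Complex.I φ j z + e * wd Complex.I F j z * φ z)
      = wd Complex.I (fun z => φ z * (e * F z)) j z * rad (kap L) (F z) := by
    intro z
    rw [wd_mul (hφ.differentiable (by norm_num) z) (heF.differentiable (by norm_num) z),
      wd_mul (differentiableAt_const _) (hFd z)]
    simp [wd]
    ring
  simp_rw [h2]
  rw [← norm_neg, ← h1]
  refine (norm_integral_le_of_norm_le (iD.const_mul (Mφ * M * (K + 1)))
    (Filter.Eventually.of_forall fun z => ?_)).trans ?_
  · by_cases hz : z ∈ tsupport φ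
    swap
    · rw [image_eq_zero_of_notMem_tsupport hz]
      have := hD0 z
      simp only [zero_mul, norm_zero]
      positivity
    have hψz := hφψ z hz
    have hzt : z ∈ tsupport ψ := subset_closure (by rw [Function.mem_support, hψz]; norm_num)
    have hDz := hD z
    rw [hψz, one_pow, one_mul] at hDz
    rw [wd_rad (kap_contDiff L) (kap_zero hL0) _ (hFd z)]
    simp only [Complex.conj_I]
    set d := deriv (kap L) (Real.posLog ‖F z‖) with hd
    set b := ‖wd (-Complex.I) F j z / F z‖ with hb
    have hb0 : 0 ≤ b := norm_nonneg _
    have n1 : |d| * ‖wd Complex.I F j z / F z‖ ≤ |d| * K := by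
      by_cases h1 : 1 ≤ ‖F z‖
      · refine mul_le_mul_of_nonneg_left ?_ (abs_nonneg _)
        rw [norm_div, div_le_iff₀ (by linarith)]
        exact hA z hzt h1
      · have : Real.posLog ‖F z‖ = 0 :=
          (Real.posLog_eq_zero_iff _).2 (by simpa using (not_le.1 h1).le)
        have : d = 0 := by
          rw [hd, this]; exact deriv_zero_of_nonpos (kap_contDiff L) (kap_zero hL0) le_rfl
        rw [this]; simp
    have n2 : ‖((d : ℝ) : ℂ) / 2 * (wd Complex.I F j z / F z +
        (starRingEnd ℂ) (wd (-Complex.I) F j z / F z))‖ ≤ (K + 1) * (|d| * (1 + b)) := by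
      rw [norm_mul, norm_div, Complex.norm_real, Real.norm_eq_abs]
      have := norm_add_le (wd Complex.I F j z / F z)
        ((starRingEnd ℂ) (wd (-Complex.I) F j z / F z))
      rw [RCLike.norm_conj] at this
      have h2 : ‖(2:ℂ)‖ = 2 := by simp
      rw [h2]
      have h3 := mul_le_mul_of_nonneg_left this (abs_nonneg d)
      have h4 : 0 ≤ |d| * K := by positivity
      have h5 : 0 ≤ |d| * b := by positivity
      have h6 : 0 ≤ |d| * b * K := by positivity
      have h7 := abs_nonneg d
      nlinarith
    rw [norm_mul, norm_mul]
    calc _ ≤ Mφ * M * ((K + 1) * (|d| * (1 + b))) :=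
          mul_le_mul (mul_le_mul (hMφ z) (he z hzt) (norm_nonneg _) hMφ0) n2 (norm_nonneg _)
            (by positivity)
      _ = Mφ * M * (K + 1) * (|d| * (1 + b)) := by ring
      _ ≤ _ := by gcongr
  · rw [integral_const_mul]
    calc _ ≤ (Mφ * M * (K + 1)) * (C1 * (η + volume.real (shell (tsupport ψ) F L) / η)) := by
          gcongr
      _ = _ := by ring

/-- Second cut-off estimate. -/
lemma cut_two {n : ℕ} (φ : (Fin n → ℂ) → ℂ) (hφ : ContDiff ℝ 1 φ)
    (ψ : (Fin n → ℂ) → ℝ) (hψ : ContDiff ℝ 1 ψ)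
    (hc : HasCompactSupport ψ) (hψ1 : ∀ z, |ψ z| ≤ 1) (hφψ : ∀ z ∈ tsupport φ, ψ z = 1)
    (hcφ : HasCompactSupport φ)
    (K : ℝ) (hK : 0 ≤ K) (j k : Fin n) :
    ∃ C : ℝ, 0 ≤ C ∧ ∀ (F : (Fin n → ℂ) → ℂ) (L : ℝ), ContDiff ℝ (⊤ : ℕ∞) F → 1 ≤ L →
      (∀ j, ∀ z ∈ tsupport ψ, 1 ≤ ‖F z‖ → ‖wd Complex.I F j z‖ ≤ K * ‖F z‖) →
      (∀ z ∈ tsupport ψ, Real.posLog ‖F z‖ ≤ L) → ∀ η : ℝ, 0 < η → η ≤ 1 →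
      ‖∫ z, rad (kap L) (F z) / F z * (wd Complex.I φ j z * wd Complex.I F k z
          - wd Complex.I φ k z * wd Complex.I F j z)‖
        ≤ C * (η + volume.real (shell (tsupport ψ) F L) / η) := by
  obtain ⟨C1, hC1, hS1⟩ := shell_est ψ hψ hc hψ1 K hK j
  obtain ⟨C2, hC2, hS2⟩ := shell_est ψ hψ hc hψ1 K hK k
  obtain ⟨Mφ, hMφ⟩ := hφ.continuous.bounded_above_of_compact_support hcφ
  have hMφ0 : 0 ≤ Mφ := (norm_nonneg _).trans (hMφ 0)
  refine ⟨(Mφ * K) * (C1 + C2), by positivity, fun F L hF hL hA hX η hη hη1 => ?_⟩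
  have hL0 : 0 < L := by linarith
  obtain ⟨D1, iD1, hD10, hD1, hDi1⟩ := hS1 F L hF hL (hA j) hX η hη hη1
  obtain ⟨D2, iD2, hD20, hD2, hDi2⟩ := hS2 F L hF hL (hA k) hX η hη hη1
  have hF1 : ContDiff ℝ 1 F := hF.of_le (by simp)
  have hFd : Differentiable ℝ F := hF1.differentiable (by norm_num)
  have hG : ContDiff ℝ 1 (fun z => rad (kap L) (F z) / F z) :=
    (rad_div_contDiff (kap_contDiff L) (kap_zero hL0)).comp hF1
  have green := wd_green (c := Complex.I) (c' := Complex.I) (j := j) (k := k) hφ hcφ hG hF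
  rw [← norm_neg, ← green]
  refine (norm_integral_le_of_norm_le ((iD1.add iD2).const_mul (Mφ * K))
    (Filter.Eventually.of_forall fun z => ?_)).trans ?_
  · simp only [Pi.add_apply]
    by_cases hz : z ∈ tsupport φ
    swap
    · rw [image_eq_zero_of_notMem_tsupport hz]
      have := hD10 z
      have := hD20 z
      simp only [zero_mul, norm_zero]
      positivity
    have hψz := hφψ z hz
    have hzt : z ∈ tsupport ψ := subset_closure (by rw [Function.mem_support, hψz]; norm_num)
    have hDz1 := hD1 z
    have hDz2 := hD2 z
    rw [hψz, one_pow, one_mul] at hDz1 hDz2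
    simp only [wd_rad_div (kap_contDiff L) (kap_zero hL0) _ (hFd z),
      wd_rad (kap_contDiff L) (kap_zero hL0) _ (hFd z), Complex.conj_I]
    set d := deriv (kap L) (Real.posLog ‖F z‖) with hd
    have e1 : φ z * (((d : ℂ) / 2 * (wd Complex.I F j z / F z +
        (starRingEnd ℂ) (wd (-Complex.I) F j z / F z)) / F z
        - rad (kap L) (F z) * wd Complex.I F j z / F z ^ 2) * wd Complex.I F k z -
        ((d : ℂ) / 2 * (wd Complex.I F k z / F z +
        (starRingEnd ℂ) (wd (-Complex.I) F k z / F z)) / F z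
        - rad (kap L) (F z) * wd Complex.I F k z / F z ^ 2) * wd Complex.I F j z) =
        φ z * ((d : ℂ) / 2 * ((starRingEnd ℂ) (wd (-Complex.I) F j z / F z) *
          (wd Complex.I F k z / F z) - (starRingEnd ℂ) (wd (-Complex.I) F k z / F z) *
          (wd Complex.I F j z / F z))) := by ring
    rw [e1]
    set b1 := ‖wd (-Complex.I) F j z / F z‖ with hb1
    set b2 := ‖wd (-Complex.I) F k z / F z‖ with hb2
    have hb10 : 0 ≤ b1 := norm_nonneg _
    have hb20 : 0 ≤ b2 := norm_nonneg _
    have n1 : ∀ j, |d| * ‖wd Complex.I F j z / F z‖ ≤ |d| * K := by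
      intro j
      by_cases h1 : 1 ≤ ‖F z‖
      · refine mul_le_mul_of_nonneg_left ?_ (abs_nonneg _)
        rw [norm_div, div_le_iff₀ (by linarith)]
        exact hA j z hzt h1
      · have : Real.posLog ‖F z‖ = 0 :=
          (Real.posLog_eq_zero_iff _).2 (by simpa using (not_le.1 h1).le)
        have : d = 0 := by
          rw [hd, this]; exact deriv_zero_of_nonpos (kap_contDiff L) (kap_zero hL0) le_rfl
        rw [this]; simp
    have n2 : ‖(d : ℂ) / 2 * ((starRingEnd ℂ) (wd (-Complex.I) F j z / F z) *
          (wd Complex.I F k z / F z) - (starRingEnd ℂ) (wd (-Complex.I) F k z / F z) *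
          (wd Complex.I F j z / F z))‖ ≤ K * (|d| * (1 + b1) + |d| * (1 + b2)) := by
      rw [norm_mul, norm_div, Complex.norm_real, Real.norm_eq_abs]
      have := norm_sub_le ((starRingEnd ℂ) (wd (-Complex.I) F j z / F z) *
          (wd Complex.I F k z / F z)) ((starRingEnd ℂ) (wd (-Complex.I) F k z / F z) *
          (wd Complex.I F j z / F z))
      rw [norm_mul (_ : ℂ) (wd Complex.I F k z / F z), norm_mul (_ : ℂ) (wd Complex.I F j z / F z),
        RCLike.norm_conj, RCLike.norm_conj] at this
      have h2 : ‖(2:ℂ)‖ = 2 := by simp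
      rw [h2]
      have h3 := mul_le_mul_of_nonneg_left this (abs_nonneg d)
      have h4 := mul_le_mul_of_nonneg_left (n1 k) hb10
      have h5 := mul_le_mul_of_nonneg_left (n1 j) hb20
      have h7 : 0 ≤ |d| * K := by positivity
      have h8 : 0 ≤ |d| * K * b1 := by positivity
      have h9 : 0 ≤ |d| * K * b2 := by positivity
      nlinarith
    rw [norm_mul]
    calc _ ≤ Mφ * (K * (|d| * (1 + b1) + |d| * (1 + b2))) :=
          mul_le_mul (hMφ z) n2 (norm_nonneg _) hMφ0
      _ = Mφ * K * (|d| * (1 + b1) + |d| * (1 + b2)) := by ring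
      _ ≤ _ := by gcongr
  · rw [integral_const_mul]
    have : ∫ z, (D1 + D2) z = (∫ z, D1 z) + ∫ z, D2 z := integral_add iD1 iD2
    rw [this]
    calc _ ≤ (Mφ * K) * (C1 * (η + volume.real (shell (tsupport ψ) F L) / η) +
            C2 * (η + volume.real (shell (tsupport ψ) F L) / η)) := by
          gcongr
      _ = _ := by ring

/-! ### Cutoffs and mollification -/

lemma exists_cutoff {n : ℕ} {Ω S : Set (Fin n → ℂ)} (hΩ : IsOpen Ω) (hS : IsCompact S)
    (hSΩ : S ⊆ Ω) : ∃ r > 0, ∃ χ : (Fin n → ℂ) → ℝ, ContDiff ℝ (⊤ : ℕ∞) χ ∧ HasCompactSupport χ ∧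
      tsupport χ ⊆ Ω ∧ (∀ z, 0 ≤ χ z) ∧ (∀ z, χ z ≤ 1) ∧ (∀ z ∈ cthickening r S, χ z = 1) ∧
      cthickening r S ⊆ Ω := by
  obtain ⟨r, hr, h⟩ := hS.exists_cthickening_subset_open hΩ hSΩ
  obtain ⟨g, g0, g1, gI⟩ := exists_contMDiffMap_zero_one_of_isClosed (n := (⊤ : ℕ∞))
    (modelWithCornersSelf ℝ (Fin n → ℂ))
    (s := (thickening r S)ᶜ) (t := cthickening (r/2) S)
    (isOpen_thickening.isClosed_compl) isClosed_cthickening (by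
      rw [disjoint_compl_left_iff_subset]
      exact cthickening_subset_thickening' hr (by linarith) S)
  have hsub : tsupport g ⊆ cthickening r S := by
    refine closure_minimal ?_ isClosed_cthickening
    intro z hz
    by_contra hc
    exact hz (g0 (fun h => hc (thickening_subset_cthickening _ _ h)))
  refine ⟨r/2, by linarith, g, g.contMDiff.contDiff, ?_, hsub.trans h, fun z => (gI z).1,
    fun z => (gI z).2, fun z hz => g1 hz, (cthickening_mono (by linarith) S).trans h⟩
  exact (hS.cthickening).of_isClosed_subset (isClosed_tsupport g) hsub

def bp (n i : ℕ) : ContDiffBump (0 : Fin n → ℂ) where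
  rIn := 1 / (2 * ((i:ℝ) + 1))
  rOut := 1 / ((i:ℝ) + 1)
  rIn_pos := by positivity
  rIn_lt_rOut := by
    apply one_div_lt_one_div_of_lt (by positivity)
    have : (0:ℝ) < i + 1 := by positivity
    linarith

def mo (n i : ℕ) (x : Fin n → ℂ) : ℂ := (((bp n i).normed volume x : ℝ) : ℂ)

def mol {n : ℕ} (i : ℕ) (g : (Fin n → ℂ) → ℂ) (x : Fin n → ℂ) : ℂ := ∫ t, g t * mo n i (x - t)

lemma mo_contDiff (n i : ℕ) : ContDiff ℝ (⊤ : ℕ∞) (mo n i) :=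
  Complex.ofRealCLM.contDiff.comp (bp n i).contDiff_normed

lemma mo_hcs (n i : ℕ) : HasCompactSupport (mo n i) :=
  (bp n i).hasCompactSupport_normed.comp_left (g := fun x : ℝ => (x:ℂ)) rfl

lemma mo_sub_contDiff {n i : ℕ} (x : Fin n → ℂ) :
    ContDiff ℝ (⊤ : ℕ∞) (fun t => mo n i (x - t)) :=
  (mo_contDiff n i).comp (contDiff_const.sub contDiff_id)

lemma mo_sub_tsupport {n i : ℕ} (x : Fin n → ℂ) :
    tsupport (fun t => mo n i (x - t)) ⊆ closedBall x (1 / ((i:ℝ) + 1)) := by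
  refine closure_minimal ?_ isClosed_closedBall
  intro t ht
  have : x - t ∈ Function.support ((bp n i).normed volume) := by
    intro h; apply ht; simp [mo, h]
  rw [(bp n i).support_normed_eq] at this
  rw [mem_closedBall, dist_eq_norm_sub']
  rw [mem_ball_zero_iff] at this
  exact this.le

lemma mo_sub_hcs {n i : ℕ} (x : Fin n → ℂ) : HasCompactSupport (fun t => mo n i (x - t)) :=
  (isCompact_closedBall x (1 / ((i:ℝ) + 1))).of_isClosed_subset (isClosed_tsupport _)
    (mo_sub_tsupport x)

lemma mol_eq_conv {n i : ℕ} (g : (Fin n → ℂ) → ℂ) :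
    mol i g = convolution ((bp n i).normed volume) g (ContinuousLinearMap.lsmul ℝ ℝ) volume := by
  ext x
  rw [convolution_eq_swap]
  unfold mol mo
  congr 1
  ext t
  simp [mul_comm]

lemma mol_eq_conv' {n i : ℕ} (g : (Fin n → ℂ) → ℂ) :
    mol i g = convolution g (mo n i) (ContinuousLinearMap.mul ℝ ℂ) volume := by
  ext x
  rfl

lemma mol_contDiff {n i : ℕ} {g : (Fin n → ℂ) → ℂ} (hg : LocallyIntegrable g) :
    ContDiff ℝ (⊤ : ℕ∞) (mol i g) := by
  rw [mol_eq_conv']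
  exact (mo_hcs n i).contDiff_convolution_right _ hg (mo_contDiff n i)

lemma mol_wd {n i : ℕ} {g : (Fin n → ℂ) → ℂ} (hg : LocallyIntegrable g) (c : ℂ) (j : Fin n)
    (x : Fin n → ℂ) :
    wd c (mol i g) j x = - ∫ t, g t * wd c (fun t => mo n i (x - t)) j t := by
  have hm1 : ContDiff ℝ 1 (mo n i) := (mo_contDiff n i).of_le (by simp)
  have h := (mo_hcs n i).hasFDerivAt_convolution_right (ContinuousLinearMap.mul ℝ ℂ) hg hm1 x
  rw [← mol_eq_conv'] at h
  have hc : ∀ v : Fin n → ℂ, Integrable (fun t => g t * fderiv ℝ (mo n i) (x - t) v) := by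
    intro v
    have cc : Continuous (fun t => fderiv ℝ (mo n i) (x - t) v) := by
      have := hm1.continuous_fderiv (by norm_num)
      fun_prop
    have hs : HasCompactSupport (fun t => fderiv ℝ (mo n i) (x - t) v) := by
      have := ((mo_hcs n i).fderiv (𝕜 := ℝ)).comp_homeomorph (Homeomorph.subLeft x)
      exact this.comp_left (g := fun l : (Fin n → ℂ) →L[ℝ] ℂ => l v) rfl
    have := hg.integrable_smul_right_of_hasCompactSupport cc hs
    simpa using this
  have hv : ∀ v, fderiv ℝ (mol i g) x v = ∫ t, g t * fderiv ℝ (mo n i) (x - t) v := by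
    intro v
    rw [h.fderiv]
    unfold convolution
    have hi : Integrable (fun t => (ContinuousLinearMap.precompR (Fin n → ℂ) (ContinuousLinearMap.mul ℝ ℂ)) (g t) (fderiv ℝ (mo n i) (x - t))) := by
      have := ((mo_hcs n i).fderiv (𝕜 := ℝ)).convolutionExists_right (ContinuousLinearMap.precompR (Fin n → ℂ) (ContinuousLinearMap.mul ℝ ℂ)) hg (hm1.continuous_fderiv (by norm_num)) x
      exact this
    rw [ContinuousLinearMap.integral_apply hi]
    rfl
  have hd : ∀ t v, fderiv ℝ (fun t => mo n i (x - t)) t v = - fderiv ℝ (mo n i) (x - t) v := by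
    intro t v
    have h1 : HasFDerivAt (fun t => mo n i (x - t)) _ t :=
      ((hm1.differentiable (by norm_num) (x - t)).hasFDerivAt).comp t
      ((hasFDerivAt_const x t).sub (hasFDerivAt_id t))
    rw [h1.fderiv]
    simp
  unfold wd
  simp only [hd, hv]
  rw [← integral_const_mul, ← integral_add (hc _) ((hc _).const_mul c), ← integral_const_mul,
    ← integral_neg]
  congr 1
  ext t
  ring

lemma mol_near {n i : ℕ} {g : (Fin n → ℂ) → ℂ} (hg : AEStronglyMeasurable g) {x : Fin n → ℂ}
    {c : ℂ} {ε : ℝ} (hε : 0 ≤ ε) (h : ∀ t ∈ ball x (1 / ((i:ℝ) + 1)), ‖g t - c‖ ≤ ε) :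
    ‖mol i g x - c‖ ≤ ε := by
  rw [mol_eq_conv, ← dist_eq_norm]
  refine dist_convolution_le hε ((bp n i).support_normed_eq.subset) (bp n i).nonneg_normed
    (bp n i).integral_normed hg (fun t ht => ?_)
  rw [dist_eq_norm]
  exact h t ht

lemma mol_bound {n i : ℕ} {g : (Fin n → ℂ) → ℂ} (hg : AEStronglyMeasurable g) {x : Fin n → ℂ}
    {C : ℝ} (hC : 0 ≤ C) (h : ∀ t ∈ ball x (1 / ((i:ℝ) + 1)), ‖g t‖ ≤ C) :
    ‖mol i g x‖ ≤ C := by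
  simpa using mol_near (c := 0) hg hC (by simpa using h)

lemma mol_ae {n : ℕ} {g : (Fin n → ℂ) → ℂ} (hg : LocallyIntegrable g) :
    ∀ᵐ x, Filter.Tendsto (fun i => mol i g x) Filter.atTop (nhds (g x)) := by
  simp only [mol_eq_conv]
  refine ContDiffBump.ae_convolution_tendsto_right_of_locallyIntegrable (K := 2) ?_ ?_ hg
  · exact tendsto_one_div_add_atTop_nhds_zero_nat
  · refine Filter.Eventually.of_forall fun i => ?_
    simp only [bp]
    have : (0:ℝ) < i + 1 := by positivity
    field_simp
    rfl

lemma cutoff_mul_continuous {n : ℕ} {Ω : Set (Fin n → ℂ)} (hΩ : IsOpen Ω)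
    {f : (Fin n → ℂ) → ℂ} (hf : ContinuousOn f Ω) {χ : (Fin n → ℂ) → ℝ} (hχ : Continuous χ)
    (hs : tsupport χ ⊆ Ω) : Continuous (fun z => (χ z : ℂ) * f z) := by
  refine ContinuousOn.continuous_of_tsupport_subset (s := Ω) ?_ hΩ ?_
  · exact (Complex.continuous_ofReal.comp hχ).continuousOn.mul hf
  · refine Subset.trans (closure_mono ?_) hs
    intro z hz h
    apply hz
    simp [h]

lemma mol_weak {n i : ℕ} {Ω : Set (Fin n → ℂ)} 
    {f f' A : (Fin n → ℂ) → ℂ} {j : Fin n} (heq : DbarEqOnC n (Ω \ f ⁻¹' {0}) f A j)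
    (hl : LocallyIntegrable f') {x : Fin n → ℂ}
    (hx : closedBall x (1 / ((i:ℝ) + 1)) ⊆ Ω \ f ⁻¹' {0})
    (hff : ∀ t ∈ closedBall x (1 / ((i:ℝ) + 1)), f' t = f t) :
    wd Complex.I (mol i f') j x = mol i (fun t => A t * f' t) x := by
  rw [mol_wd hl]
  have h := heq (fun t => mo n i (x - t)) ⟨mo_sub_contDiff x, mo_sub_hcs x,
    (mo_sub_tsupport x).trans hx⟩
  rw [← wd_I] at h
  have e1 : ∫ z in Ω \ f ⁻¹' {0}, f z * wd Complex.I (fun t => mo n i (x - t)) j z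
      = ∫ z, f' z * wd Complex.I (fun t => mo n i (x - t)) j z := by
    rw [setIntegral_eq_integral_of_forall_compl_eq_zero]
    · congr 1
      ext t
      by_cases ht : t ∈ closedBall x (1 / ((i:ℝ) + 1))
      · rw [hff t ht]
      · rw [wd_support (fun h => ht (mo_sub_tsupport x h))]; simp
    · intro t ht
      rw [wd_support (fun h => ht (hx (mo_sub_tsupport x h)))]; simp
  have e2 : ∫ z in Ω \ f ⁻¹' {0}, A z * f z * mo n i (x - z)
      = ∫ z, A z * f' z * mo n i (x - z) := by
    have h0 : ∀ t, t ∉ closedBall x (1 / ((i:ℝ) + 1)) → mo n i (x - t) = 0 := fun t ht =>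
      image_eq_zero_of_notMem_tsupport (f := fun t => mo n i (x - t))
        (fun h => ht (mo_sub_tsupport x h))
    rw [setIntegral_eq_integral_of_forall_compl_eq_zero]
    · congr 1
      ext t
      by_cases ht : t ∈ closedBall x (1 / ((i:ℝ) + 1))
      · rw [hff t ht]
      · rw [h0 t ht]; simp
    · intro t ht
      rw [h0 t (fun h => ht (hx h))]; simp
  rw [e1, e2] at h
  rw [h, neg_neg]
  rfl

lemma approx {n : ℕ} {Ω : Set (Fin n → ℂ)} (hΩ : IsOpen Ω)
    {f : (Fin n → ℂ) → ℂ} (hf : ContinuousOn f Ω)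
    {K : ℝ} (hK : 0 ≤ K) {A : Fin n → (Fin n → ℂ) → ℂ} (hAm : ∀ j, Measurable (A j))
    (hAK : ∀ j z, ‖A j z‖ ≤ K) 
    (heq : ∀ j, DbarEqOnC n (Ω \ f ⁻¹' {0}) f (A j) j)
    {S : Set (Fin n → ℂ)} (hS : IsCompact S) (hSΩ : S ⊆ Ω) :
    ∃ F : ℕ → (Fin n → ℂ) → ℂ, (∀ i, ContDiff ℝ (⊤ : ℕ∞) (F i)) ∧
      (∀ ε > 0, ∀ᶠ i in Filter.atTop, ∀ z ∈ S, ‖F i z - f z‖ ≤ ε) ∧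
      (∀ ε > 0, ∀ᶠ i in Filter.atTop, ∀ z ∈ S, ε ≤ ‖F i z‖ →
        ∀ j, ‖wd Complex.I (F i) j z‖ ≤ 2 * K * ‖F i z‖) ∧
      (∀ᵐ z, z ∈ S → f z ≠ 0 → ∀ j,
        Filter.Tendsto (fun i => wd Complex.I (F i) j z) Filter.atTop (nhds (A j z * f z))) := by
  obtain ⟨r, hr, χ, hχ, hχc, hχΩ, hχ0, hχ1, hχr, hrΩ⟩ := exists_cutoff hΩ hS hSΩ
  set f' : (Fin n → ℂ) → ℂ := fun z => (χ z : ℂ) * f z with hf'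
  have cf : Continuous f' := cutoff_mul_continuous hΩ hf hχ.continuous hχΩ
  have sf : HasCompactSupport f' := HasCompactSupport.intro hχc fun z hz => by
    simp [hf', image_eq_zero_of_notMem_tsupport hz]
  have uf : UniformContinuous f' := sf.uniformContinuous_of_continuous cf
  have If : Integrable f' := cf.integrable_of_hasCompactSupport sf
  have ef : ∀ z ∈ cthickening r S, f' z = f z := fun z hz => by simp [hf', hχr z hz]
  have eS : ∀ z ∈ S, f' z = f z := fun z hz => ef z (self_subset_cthickening S hz)
  have If2 : ∀ j, Integrable (fun t => A j t * f' t) := fun j =>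
    If.bdd_mul (c := K) (hAm j).aestronglyMeasurable (Filter.Eventually.of_forall (hAK j))
  have tz : Filter.Tendsto (fun i : ℕ => 1 / ((i:ℝ) + 1)) Filter.atTop (nhds 0) :=
    tendsto_one_div_add_atTop_nhds_zero_nat
  -- the local identity
  have key : ∀ i : ℕ, 1 / ((i:ℝ) + 1) ≤ r → ∀ x ∈ S,
      (∀ t ∈ closedBall x (1 / ((i:ℝ) + 1)), f' t ≠ 0) → ∀ j,
      wd Complex.I (mol i f') j x = mol i (fun t => A j t * f' t) x := by
    intro i hi x hx h0 j
    have hsub : closedBall x (1 / ((i:ℝ) + 1)) ⊆ cthickening r S :=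
      (closedBall_subset_cthickening hx _).trans (cthickening_mono hi S)
    refine mol_weak (heq j) If.locallyIntegrable (fun t ht => ⟨hrΩ (hsub ht), fun h => h0 t ht ?_⟩)
      (fun t ht => ef t (hsub ht))
    rw [ef t (hsub ht)]; exact h
  have osc : ∀ ε > 0, ∀ᶠ i : ℕ in Filter.atTop, 1 / ((i:ℝ) + 1) ≤ r ∧
      ∀ x, ∀ t ∈ closedBall x (1 / ((i:ℝ) + 1)), ‖f' t - f' x‖ ≤ ε := by
    intro ε hε
    obtain ⟨δ, hδ, h⟩ := Metric.uniformContinuous_iff.1 uf ε hε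
    filter_upwards [tz.eventually (gt_mem_nhds (lt_min hr hδ))] with i hi
    refine ⟨(hi.trans_le (min_le_left _ _)).le, fun x t ht => ?_⟩
    rw [← dist_eq_norm]
    exact (h ((mem_closedBall.1 ht).trans_lt (hi.trans_le (min_le_right _ _)))).le
  have near : ∀ (i : ℕ) (ε : ℝ), 0 < ε →
      (∀ x, ∀ t ∈ closedBall x (1 / ((i:ℝ) + 1)), ‖f' t - f' x‖ ≤ ε) → ∀ x,
      ‖mol i f' x - f' x‖ ≤ ε := fun i ε hε h x =>
    mol_near cf.aestronglyMeasurable hε.le (fun t ht => h x t (ball_subset_closedBall ht))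
  refine ⟨fun i => mol i f', fun i => mol_contDiff If.locallyIntegrable, ?_, ?_, ?_⟩
  · intro ε hε
    filter_upwards [osc ε hε] with i hi z hz
    rw [← eS z hz]
    exact near i ε hε hi.2 z
  · intro ε hε
    filter_upwards [osc (ε/4) (by positivity)] with i hi z hz hzε j
    have h1 := near i _ (by positivity) hi.2 z
    have h2 : ‖f' z‖ ≤ ‖mol i f' z‖ + ε/4 := by
      have := norm_sub_norm_le (f' z) (mol i f' z)
      rw [norm_sub_rev] at this; linarith
    have h3 : ‖mol i f' z‖ ≤ ‖f' z‖ + ε/4 := by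
      have := norm_sub_norm_le (mol i f' z) (f' z)
      linarith
    have h4 : ∀ t ∈ closedBall z (1 / ((i:ℝ) + 1)), ‖f' z‖ - ε/4 ≤ ‖f' t‖ ∧
        ‖f' t‖ ≤ ‖f' z‖ + ε/4 := fun t ht => by
      have := hi.2 z t ht
      have e1 := norm_sub_norm_le (f' t) (f' z)
      have e2 := norm_sub_norm_le (f' z) (f' t)
      rw [norm_sub_rev] at e2
      constructor <;> linarith
    rw [key i hi.1 z hz (fun t ht h => by
      have := (h4 t ht).1
      rw [h, norm_zero] at this; linarith) j]
    refine mol_bound (If2 j).aestronglyMeasurable (by positivity) fun t ht => ?_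
    rw [norm_mul]
    have h5 := (h4 t (ball_subset_closedBall ht)).2
    calc ‖A j t‖ * ‖f' t‖ ≤ K * (2 * ‖mol i f' z‖) := by
          gcongr
          · exact hAK j t
          · linarith
      _ = _ := by ring
  · have := ae_all_iff.2 fun j => mol_ae (If2 j).locallyIntegrable
    filter_upwards [this] with z hz hzS hz0 j
    have h1 := hz j
    rw [eS z hzS] at h1
    refine h1.congr' ?_
    have hpos : 0 < ‖f' z‖ := by rw [eS z hzS]; exact norm_pos_iff.2 hz0
    filter_upwards [osc (‖f' z‖/2) (by positivity)] with i hi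
    rw [key i hi.1 z hzS (fun t ht h => ?_) j]
    have := hi.2 z t ht
    rw [h, zero_sub, norm_neg] at this
    linarith

lemma rad_kap_norm (L : ℝ) (w : ℂ) : ‖rad (kap L) w‖ ≤ 1 := by
  unfold rad
  rw [Complex.norm_real, Real.norm_of_nonneg (kap_nonneg _ _)]
  exact kap_le_one _ _

lemma shell_sub {n : ℕ} {S : Set (Fin n → ℂ)} {f F : (Fin n → ℂ) → ℂ} {M L : ℝ} (hM : 0 < M)
    (hL : 1 ≤ L) (h : ∀ z ∈ S, ‖F z - f z‖ ≤ M * Real.exp (-L) / 2) :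
    shell S (fun z => F z / ((M * Real.exp (-L) : ℝ) : ℂ)) L ⊆
      {z ∈ S | 0 < ‖f z‖ ∧ ‖f z‖ ≤ 2 * M * Real.exp (-L/2)} := by
  intro z hz
  obtain ⟨hzS, h1, h2⟩ := hz
  have hε : 0 < M * Real.exp (-L) := by positivity
  have hd := h z hzS
  set ε := M * Real.exp (-L) with hεd
  simp only [norm_div, Complex.norm_real, Real.norm_of_nonneg hε.le] at h1 h2
  have ha : 1 < ‖F z‖ / ε := by
    by_contra hc
    push Not at hc
    have : Real.posLog (‖F z‖ / ε) = 0 := by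
      rw [Real.posLog_eq_zero_iff, abs_of_nonneg (by positivity)]; exact hc
    rw [this] at h1; linarith
  have hb : Real.log (‖F z‖ / ε) ≤ L / 2 := by
    refine le_trans ?_ h2
    exact le_max_right _ _
  have hc : ‖F z‖ ≤ M * Real.exp (-L/2) := by
    rw [Real.log_le_iff_le_exp (by linarith), div_le_iff₀ hε] at hb
    have : Real.exp (L/2) * ε = M * Real.exp (-L/2) := by
      rw [hεd, mul_left_comm, ← Real.exp_add]; congr 2; ring
    linarith
  rw [lt_div_iff₀ hε] at ha
  have hle : ε ≤ M * Real.exp (-L/2) := by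
    rw [hεd]; gcongr; linarith
  have e1 := norm_sub_norm_le (f z) (F z)
  have e2 := norm_sub_norm_le (F z) (f z)
  rw [norm_sub_rev] at e1
  refine ⟨hzS, by linarith, by linarith⟩

lemma limit_abs {n : ℕ} {S : Set (Fin n → ℂ)} (hS : IsCompact S) {f : (Fin n → ℂ) → ℂ}
    (hf : ContinuousOn f S) {F : ℕ → (Fin n → ℂ) → ℂ} (hF : ∀ i, Continuous (F i))
    (hFf : ∀ ε > 0, ∀ᶠ i in Filter.atTop, ∀ z ∈ S, ‖F i z - f z‖ ≤ ε)
    {H : ℕ → (Fin n → ℂ) → ℂ} {G : (Fin n → ℂ) → ℂ} (hHm : ∀ i, AEStronglyMeasurable (H i))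
    (hH0 : ∀ i, ∀ z ∉ S, H i z = 0)
    (hHG : ∀ᵐ z, z ∈ S → f z ≠ 0 → Filter.Tendsto (fun i => H i z) Filter.atTop (nhds (G z)))
    (hG0 : ∀ z, z ∉ S → G z = 0) (hG1 : ∀ z, f z = 0 → G z = 0) {B : ℝ} (hB0 : 0 ≤ B)
    (hB : ∀ ε > 0, ∀ᶠ i in Filter.atTop, ∀ z ∈ S, ε ≤ ‖F i z‖ → ‖H i z‖ ≤ B)
    {M : ℝ} (hM : 0 < M) {C : ℝ} (hC : 0 ≤ C)
    (hcut : ∀ L : ℝ, 1 ≤ L → ∀ᶠ i in Filter.atTop, ∀ η : ℝ, 0 < η → η ≤ 1 →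
      ‖∫ z, rad (kap L) (F i z / ((M * Real.exp (-L) : ℝ) : ℂ)) * H i z‖ ≤
      C * (η + volume.real (shell S (fun z => F i z / ((M * Real.exp (-L) : ℝ) : ℂ)) L) / η)) :
    ∫ z, G z = 0 := by
  classical
  have hSm : MeasurableSet S := hS.isClosed.measurableSet
  have hSf : volume S ≠ ⊤ := hS.measure_lt_top.ne
  have iS : Integrable (S.indicator fun _ => B) :=
    (integrable_indicator_iff hSm).2 (integrableOn_const (by simpa using hSf))
  have ptF : ∀ z ∈ S, Filter.Tendsto (fun i => F i z) Filter.atTop (nhds (f z)) := by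
    intro z hz
    rw [Metric.tendsto_nhds]
    intro ε hε
    filter_upwards [hFf (ε/2) (by positivity)] with i hi
    rw [dist_eq_norm]
    linarith [hi z hz]
  set T : ℝ → Set (Fin n → ℂ) := fun L => {z ∈ S | 0 < ‖f z‖ ∧ ‖f z‖ ≤ 2 * M * Real.exp (-L/2)}
    with hT
  have hTf : ∀ L, volume (T L) ≠ ⊤ := fun L => ((measure_mono fun z hz => hz.1).trans_lt
    hS.measure_lt_top).ne
  have hcr : ∀ L : ℝ, 1 ≤ L → Continuous (rad (kap L)) := fun L hL =>
    (rad_contDiff (kap_contDiff L) (kap_zero (by linarith))).continuous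
  -- first limit
  have st1 : ∀ L : ℝ, 1 ≤ L → AEStronglyMeasurable
      (fun z => rad (kap L) (f z / ((M * Real.exp (-L) : ℝ) : ℂ)) * G z) ∧
      ∀ η : ℝ, 0 < η → η ≤ 1 →
      ‖∫ z, rad (kap L) (f z / ((M * Real.exp (-L) : ℝ) : ℂ)) * G z‖ ≤
        C * (η + volume.real (T L) / η) := by
    intro L hL
    have hL0 : 0 < L := by linarith
    have hε : 0 < M * Real.exp (-L) := by positivity
    have hsh := (hFf (M * Real.exp (-L) / 2) (by positivity)).mono fun i hi => shell_sub hM hL hi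
    have hct := hcut L hL
    set ε := M * Real.exp (-L) with hεd
    have hm : ∀ i, AEStronglyMeasurable (fun z => rad (kap L) (F i z / (ε:ℂ)) * H i z) := fun i =>
      (((hcr L hL).comp ((hF i).div_const _)).aestronglyMeasurable).mul (hHm i)
    have hlim : ∀ᵐ z, Filter.Tendsto (fun i => rad (kap L) (F i z / (ε:ℂ)) * H i z) Filter.atTop
        (nhds (rad (kap L) (f z / (ε:ℂ)) * G z)) := by
      filter_upwards [hHG] with z hz
      by_cases hzS : z ∈ S
      · by_cases h0 : f z = 0
        · rw [hG1 z h0, mul_zero]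
          refine tendsto_const_nhds.congr' ?_
          filter_upwards [hFf ε hε] with i hi
          rw [rad_eq_zero (kap_zero hL0), zero_mul]
          have := hi z hzS
          rw [h0, sub_zero] at this
          rw [norm_div, Complex.norm_real, Real.norm_of_nonneg hε.le]
          exact div_le_one_of_le₀ this hε.le
        · refine Filter.Tendsto.mul ?_ (hz hzS h0)
          exact ((hcr L hL).tendsto _).comp ((ptF z hzS).div_const _)
      · simp [hH0 _ z hzS, hG0 z hzS]
    refine ⟨aestronglyMeasurable_of_tendsto_ae Filter.atTop hm hlim, fun η hη hη1 => ?_⟩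
    have hdom : Filter.Tendsto (fun i => ∫ z, rad (kap L) (F i z / (ε:ℂ)) * H i z) Filter.atTop
        (nhds (∫ z, rad (kap L) (f z / (ε:ℂ)) * G z)) := by
      refine tendsto_integral_filter_of_dominated_convergence (S.indicator fun _ => B)
        (Filter.Eventually.of_forall hm) ?_ iS hlim
      filter_upwards [hB ε hε] with i hi
      refine Filter.Eventually.of_forall fun z => ?_
      by_cases hzS : z ∈ S
      · rw [indicator_of_mem hzS]
        by_cases hz : ε ≤ ‖F i z‖
        · rw [norm_mul]
          calc _ ≤ 1 * B := mul_le_mul (rad_kap_norm _ _) (hi z hzS hz) (norm_nonneg _) zero_le_one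
            _ = B := one_mul B
        · rw [rad_eq_zero (kap_zero hL0), zero_mul, norm_zero]
          · exact hB0
          rw [norm_div, Complex.norm_real, Real.norm_of_nonneg hε.le]
          exact div_le_one_of_le₀ (not_le.1 hz).le hε.le
      · rw [indicator_of_notMem hzS, hH0 i z hzS]; simp
    refine le_of_tendsto hdom.norm ?_
    filter_upwards [hct, hsh] with i h1 h2
    refine (h1 η hη hη1).trans ?_
    have := measureReal_mono (μ := volume) h2 (hTf L)
    refine mul_le_mul_of_nonneg_left (add_le_add le_rfl (div_le_div_of_nonneg_right this hη.le)) hC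
  -- measure of T tends to zero
  set f0 : (Fin n → ℂ) → ℂ := S.piecewise f 0 with hf0
  have mf0 : Measurable f0 := hf.measurable_piecewise continuousOn_const hSm
  have hTm : ∀ L, MeasurableSet (T L) := by
    intro L
    have : T L = S ∩ f0 ⁻¹' {w | 0 < ‖w‖ ∧ ‖w‖ ≤ 2 * M * Real.exp (-L/2)} := by
      ext z
      constructor
      · rintro ⟨h1, h2⟩
        refine ⟨h1, ?_⟩
        simpa [hf0, piecewise, h1] using h2
      · rintro ⟨h1, h2⟩
        refine ⟨h1, ?_⟩
        simpa [hf0, piecewise, h1] using h2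
    rw [this]
    refine hSm.inter (mf0 ?_)
    exact (measurableSet_lt measurable_const measurable_norm).inter
      (measurableSet_le measurable_norm measurable_const)
  have hexp : Filter.Tendsto (fun k : ℕ => 2 * M * Real.exp (-((k:ℝ)+1)/2)) Filter.atTop (nhds 0) := by
    have : Filter.Tendsto (fun k : ℕ => ((k:ℝ)+1)/2) Filter.atTop Filter.atTop :=
      (Filter.tendsto_atTop_add_const_right _ _ tendsto_natCast_atTop_atTop).atTop_div_const
        (by norm_num)
    have h := (Real.tendsto_exp_neg_atTop_nhds_zero.comp this).const_mul (2*M)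
    rw [mul_zero] at h
    refine h.congr fun k => ?_
    simp only [Function.comp]
    congr 2
    ring
  have hTlim : Filter.Tendsto (fun k : ℕ => volume.real (T ((k:ℝ)+1))) Filter.atTop (nhds 0) := by
    have h := tendsto_measure_iInter_atTop (μ := volume) (s := fun k : ℕ => T ((k:ℝ)+1))
      (fun k => (hTm _).nullMeasurableSet) (by
        intro a b hab z hz
        refine ⟨hz.1, hz.2.1, hz.2.2.trans ?_⟩
        have : (a:ℝ) ≤ b := by exact_mod_cast hab
        gcongr) ⟨0, hTf _⟩
    have he : (⋂ k : ℕ, T ((k:ℝ)+1)) = ∅ := by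
      rw [eq_empty_iff_forall_notMem]
      intro z hz
      rw [mem_iInter] at hz
      have h1 := (hz 0).2.1
      obtain ⟨k, hk⟩ := (hexp.eventually (gt_mem_nhds h1)).exists
      exact absurd (hz k).2.2 (not_le.2 hk)
    rw [he, measure_empty] at h
    have := (ENNReal.tendsto_toReal (ENNReal.zero_ne_top)).comp h
    rw [ENNReal.toReal_zero] at this
    exact this
  -- bound on G
  have hGB : ∀ᵐ z, ‖G z‖ ≤ S.indicator (fun _ => B) z := by
    filter_upwards [hHG] with z hz
    by_cases hzS : z ∈ S
    · rw [indicator_of_mem hzS]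
      by_cases h0 : f z = 0
      · rw [hG1 z h0]; simpa using hB0
      · refine le_of_tendsto (hz hzS h0).norm ?_
        have hp : 0 < ‖f z‖ := norm_pos_iff.2 h0
        filter_upwards [hB (‖f z‖/2) (by positivity),
          (ptF z hzS).norm.eventually (lt_mem_nhds (show ‖f z‖/2 < ‖f z‖ by linarith))] with i h1 h2
        exact h1 z hzS h2.le
    · rw [indicator_of_notMem hzS, hG0 z hzS]; simp
  have hlim2 : Filter.Tendsto (fun k : ℕ => ∫ z,
      rad (kap ((k:ℝ)+1)) (f z / ((M * Real.exp (-((k:ℝ)+1)) : ℝ) : ℂ)) * G z) Filter.atTop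
      (nhds (∫ z, G z)) := by
    refine tendsto_integral_filter_of_dominated_convergence (S.indicator fun _ => B)
      (Filter.Eventually.of_forall fun k => (st1 ((k:ℝ)+1) (by linarith [Nat.cast_nonneg (α := ℝ) k])).1) ?_ iS ?_
    · refine Filter.Eventually.of_forall fun k => ?_
      filter_upwards [hGB] with z hz
      rw [norm_mul]
      refine le_trans ?_ hz
      exact mul_le_of_le_one_left (norm_nonneg _) (rad_kap_norm _ _)
    · refine Filter.Eventually.of_forall fun z => ?_
      by_cases h0 : f z = 0
      · simp [hG1 z h0]
      · refine tendsto_const_nhds.congr' ?_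
        have hp : 0 < ‖f z‖ := norm_pos_iff.2 h0
        filter_upwards [hexp.eventually (gt_mem_nhds hp)] with k hk
        have hk0 : (0:ℝ) ≤ k := Nat.cast_nonneg k
        set L : ℝ := (k:ℝ) + 1 with hLd
        have hL0 : 0 < L := by linarith
        have : rad (kap L) (f z / ((M * Real.exp (-L) : ℝ) : ℂ)) = 1 := by
          unfold rad
          rw [kap_one hL0]
          · simp
          rw [norm_div, Complex.norm_real, Real.norm_of_nonneg (by positivity)]
          refine le_trans ?_ (le_max_right 0 _)
          rw [Real.le_log_iff_exp_le (by positivity), le_div_iff₀ (by positivity)]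
          have e : Real.exp (L/2) * (M * Real.exp (-L)) = M * Real.exp (-L/2) := by
            rw [mul_left_comm, ← Real.exp_add]; congr 2; ring
          rw [e]
          have : 0 < M * Real.exp (-L/2) := by positivity
          linarith
        rw [this, one_mul]
  have fin : ∀ η : ℝ, 0 < η → η ≤ 1 → ‖∫ z, G z‖ ≤ C * η := by
    intro η hη hη1
    have h1 : Filter.Tendsto (fun k : ℕ => C * (η + volume.real (T ((k:ℝ)+1)) / η)) Filter.atTop
      (nhds (C * (η + 0 / η))) := ((hTlim.div_const η).const_add η).const_mul C
    rw [zero_div, add_zero] at h1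
    exact le_of_tendsto_of_tendsto' hlim2.norm h1 fun k =>
      (st1 ((k:ℝ)+1) (by linarith [Nat.cast_nonneg (α := ℝ) k])).2 η hη hη1
  rw [← norm_le_zero_iff]
  have h2 : Filter.Tendsto (fun k : ℕ => C * (1 / ((k:ℝ)+1))) Filter.atTop (nhds (C * 0)) :=
    tendsto_one_div_add_atTop_nhds_zero_nat.const_mul C
  rw [mul_zero] at h2
  refine ge_of_tendsto' h2 fun k => fin _ (by positivity) ?_
  rw [div_le_one (by positivity)]
  linarith [Nat.cast_nonneg (α := ℝ) k]

lemma wd_div_const {n : ℕ} {c : ℂ} {F : (Fin n → ℂ) → ℂ} {j : Fin n} {z : Fin n → ℂ}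
    (hF : DifferentiableAt ℝ F z) (a : ℂ) :
    wd c (fun w => F w / a) j z = wd c F j z / a := by
  have h : HasFDerivAt (fun w => F w / a) (a⁻¹ • fderiv ℝ F z) z := by
    have h1 : HasFDerivAt (fun w => a⁻¹ • F w) (a⁻¹ • fderiv ℝ F z) z :=
      hF.hasFDerivAt.const_smul a⁻¹
    have e : (fun w => F w / a) = (fun w => a⁻¹ • F w) := by
      ext w; rw [div_eq_inv_mul, smul_eq_mul]
    rw [e]; exact h1
  unfold wd
  rw [h.fderiv]
  simp only [smul_apply, smul_eq_mul]
  ring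

lemma scaled_bounds {n : ℕ} {S : Set (Fin n → ℂ)} {F : (Fin n → ℂ) → ℂ} {K M L : ℝ} (hM : 0 < M)
    (hL : 1 ≤ L) (hF : ContDiff ℝ (⊤ : ℕ∞) F)
    (hFM : ∀ z ∈ S, ‖F z‖ ≤ M)
    (hA : ∀ z ∈ S, M * Real.exp (-L) ≤ ‖F z‖ → ∀ j, ‖wd Complex.I F j z‖ ≤ K * ‖F z‖) :
    (∀ j, ∀ z ∈ S, 1 ≤ ‖F z / ((M * Real.exp (-L) : ℝ) : ℂ)‖ →
      ‖wd Complex.I (fun z => F z / ((M * Real.exp (-L) : ℝ) : ℂ)) j z‖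
        ≤ K * ‖F z / ((M * Real.exp (-L) : ℝ) : ℂ)‖) ∧
    (∀ z ∈ S, Real.posLog ‖F z / ((M * Real.exp (-L) : ℝ) : ℂ)‖ ≤ L) := by
  have hε : 0 < M * Real.exp (-L) := by positivity
  constructor
  · intro j z hz h1
    rw [wd_div_const (hF.differentiable (by simp) z)]
    rw [norm_div, Complex.norm_real, Real.norm_of_nonneg hε.le] at h1 ⊢
    rw [le_div_iff₀ hε, one_mul] at h1
    rw [norm_div, Complex.norm_real, Real.norm_of_nonneg hε.le, ← mul_div_assoc]
    exact div_le_div_of_nonneg_right (hA z hz h1 j) hε.le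
  · intro z hz
    rw [norm_div, Complex.norm_real, Real.norm_of_nonneg hε.le]
    refine max_le (by linarith) ?_
    rcases (norm_nonneg (F z)).eq_or_lt with h0 | h0
    · rw [← h0]; simp; linarith
    rw [Real.log_le_iff_le_exp (by positivity), div_le_iff₀ hε]
    have : Real.exp L * (M * Real.exp (-L)) = M := by
      rw [mul_left_comm, ← Real.exp_add]; simp
    rw [this]
    exact hFM z hz

lemma hcs_bound {n : ℕ} {g : (Fin n → ℂ) → ℂ} (hg : Continuous g) (hc : HasCompactSupport g) :
    ∃ c : ℝ, 0 ≤ c ∧ ∀ z, ‖g z‖ ≤ c := by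
  obtain ⟨c, h⟩ := hg.bounded_above_of_compact_support hc
  exact ⟨c, (norm_nonneg _).trans (h 0), h⟩

lemma weak_one {n : ℕ} {Ω : Set (Fin n → ℂ)} (hΩ : IsOpen Ω)
    {f : (Fin n → ℂ) → ℂ} (hf : ContinuousOn f Ω)
    {K : ℝ} (hK : 0 ≤ K) {A : Fin n → (Fin n → ℂ) → ℂ} (hAm : ∀ j, Measurable (A j))
    (hAK : ∀ j z, ‖A j z‖ ≤ K)
    (heq : ∀ j, DbarEqOnC n (Ω \ f ⁻¹' {0}) f (A j) j)
    {φ : (Fin n → ℂ) → ℂ} (hφ : IsTestC n Ω φ) (j : Fin n) :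
    ∫ z, (f z * wd Complex.I φ j z + A j z * f z * φ z) = 0 := by
  obtain ⟨hφs, hφc, hφΩ⟩ := hφ
  obtain ⟨r, hr, ψ, hψ, hψc, hψΩ, hψ0, hψ1, hψr, -⟩ := exists_cutoff hΩ hφc hφΩ
  obtain ⟨F, hFs, hFf, hFA, hFl⟩ := approx hΩ hf hK hAm hAK heq hψc hψΩ
  have hfS : ContinuousOn f (tsupport ψ) := hf.mono hψΩ
  obtain ⟨M0, hM0⟩ := hψc.exists_bound_of_continuousOn hfS
  set M := |M0| + 1 with hMd
  have hM : 0 < M := by positivity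
  have hFM : ∀ᶠ i in Filter.atTop, ∀ z ∈ tsupport ψ, ‖F i z‖ ≤ M := by
    filter_upwards [hFf 1 one_pos] with i hi z hz
    have := norm_sub_norm_le (F i z) (f z)
    linarith [hi z hz, hM0 z hz, le_abs_self M0]
  have hφ1 : ContDiff ℝ 1 φ := hφs.of_le (by simp)
  have hψ1' : ∀ z ∈ tsupport φ, ψ z = 1 := fun z hz => hψr z (self_subset_cthickening _ hz)
  have hsub : tsupport φ ⊆ tsupport ψ := fun z hz =>
    subset_tsupport _ (by simp [Function.mem_support, hψ1' z hz])
  obtain ⟨C, hC, hcut⟩ := cut_one φ hφ1 ψ (hψ.of_le (by simp)) hψc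
    (fun z => by rw [abs_of_nonneg (hψ0 z)]; exact hψ1 z) hψ1'
    hφc (2*K) (by positivity) M hM.le j
  obtain ⟨c0, hc0, hb0⟩ := hcs_bound hφs.continuous hφc
  obtain ⟨c1, hc1, hb1⟩ := hcs_bound (wd_continuous (c := Complex.I) (j := j) hφ1) (wd_hcs hφc)
  refine limit_abs hψc hfS (fun i => (hFs i).continuous) hFf
    (H := fun i z => F i z * wd Complex.I φ j z + wd Complex.I (F i) j z * φ z)
    (B := M * c1 + 2 * K * M * c0) (M := M) (C := C) ?_ ?_ ?_ ?_ ?_ (by positivity) ?_ hM hC ?_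
  · intro i
    refine Continuous.aestronglyMeasurable ?_
    exact ((hFs i).continuous.mul (wd_continuous hφ1)).add
      ((wd_continuous ((hFs i).of_le (by simp))).mul hφ1.continuous)
  · intro i z hz
    rw [wd_support (fun h => hz (hsub h)), image_eq_zero_of_notMem_tsupport (fun h => hz (hsub h))]
    simp
  · filter_upwards [hFl] with z hz hzS h0
    have h1 : Filter.Tendsto (fun i => F i z) Filter.atTop (nhds (f z)) := by
      rw [Metric.tendsto_nhds]
      intro ε hε
      filter_upwards [hFf (ε/2) (by positivity)] with i hi
      rw [dist_eq_norm]
      linarith [hi z hzS]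
    exact (h1.mul_const _).add ((hz hzS h0 j).mul_const _)
  · intro z hz
    rw [wd_support (fun h => hz (hsub h)), image_eq_zero_of_notMem_tsupport (fun h => hz (hsub h))]
    simp
  · intro z hz; simp [hz]
  · intro ε hε
    filter_upwards [hFA ε hε, hFM] with i h1 h2 z hz hzε
    refine (norm_add_le _ _).trans ?_
    rw [norm_mul, norm_mul]
    have := h1 z hz hzε j
    gcongr
    · exact h2 z hz
    · exact hb1 z
    · refine this.trans ?_
      gcongr
      exact h2 z hz
    · exact hb0 z
  · intro L hL
    have hε : 0 < M * Real.exp (-L) := by positivity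
    filter_upwards [hFA _ hε, hFM] with i h1 h2 η hη hη1
    obtain ⟨g1, g2⟩ := scaled_bounds hM hL (hFs i) h2 h1
    have hε' : ((M * Real.exp (-L) : ℝ) : ℂ) ≠ 0 := by exact_mod_cast hε.ne'
    have key := hcut (fun z => F i z / ((M * Real.exp (-L) : ℝ) : ℂ)) L (M * Real.exp (-L))
      ((hFs i).div_const _) hL (g1 j) g2 (fun z hz => by
        rw [mul_div_cancel₀ _ hε']; exact h2 z hz) η hη hη1
    refine le_trans (le_of_eq ?_) key
    congr 2
    ext z
    rw [wd_div_const ((hFs i).differentiable (by simp) z), mul_div_cancel₀ _ hε',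
      mul_div_cancel₀ _ hε']

lemma weak_two {n : ℕ} {Ω : Set (Fin n → ℂ)} (hΩ : IsOpen Ω)
    {f : (Fin n → ℂ) → ℂ} (hf : ContinuousOn f Ω)
    {K : ℝ} (hK : 0 ≤ K) {A : Fin n → (Fin n → ℂ) → ℂ} (hAm : ∀ j, Measurable (A j))
    (hAK : ∀ j z, ‖A j z‖ ≤ K) (hA0 : ∀ j z, f z = 0 → A j z = 0)
    (heq : ∀ j, DbarEqOnC n (Ω \ f ⁻¹' {0}) f (A j) j)
    {φ : (Fin n → ℂ) → ℂ} (hφ : IsTestC n Ω φ) (j k : Fin n) :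
    ∫ z, (wd Complex.I φ j z * A k z - wd Complex.I φ k z * A j z) = 0 := by
  obtain ⟨hφs, hφc, hφΩ⟩ := hφ
  obtain ⟨r, hr, ψ, hψ, hψc, hψΩ, hψ0, hψ1, hψr, -⟩ := exists_cutoff hΩ hφc hφΩ
  obtain ⟨F, hFs, hFf, hFA, hFl⟩ := approx hΩ hf hK hAm hAK heq hψc hψΩ
  have hfS : ContinuousOn f (tsupport ψ) := hf.mono hψΩ
  obtain ⟨M0, hM0⟩ := hψc.exists_bound_of_continuousOn hfS
  set M := |M0| + 1 with hMd
  have hM : 0 < M := by positivity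
  have hFM : ∀ᶠ i in Filter.atTop, ∀ z ∈ tsupport ψ, ‖F i z‖ ≤ M := by
    filter_upwards [hFf 1 one_pos] with i hi z hz
    have := norm_sub_norm_le (F i z) (f z)
    linarith [hi z hz, hM0 z hz, le_abs_self M0]
  have hφ1 : ContDiff ℝ 1 φ := hφs.of_le (by simp)
  have hψ1' : ∀ z ∈ tsupport φ, ψ z = 1 := fun z hz => hψr z (self_subset_cthickening _ hz)
  have hsub : tsupport φ ⊆ tsupport ψ := fun z hz =>
    subset_tsupport _ (by simp [Function.mem_support, hψ1' z hz])
  obtain ⟨C, hC, hcut⟩ := cut_two φ hφ1 ψ (hψ.of_le (by simp)) hψc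
    (fun z => by rw [abs_of_nonneg (hψ0 z)]; exact hψ1 z) hψ1'
    hφc (2*K) (by positivity) j k
  obtain ⟨cj, hcj, hbj⟩ := hcs_bound (wd_continuous (c := Complex.I) (j := j) hφ1) (wd_hcs hφc)
  obtain ⟨ck, hck, hbk⟩ := hcs_bound (wd_continuous (c := Complex.I) (j := k) hφ1) (wd_hcs hφc)
  refine limit_abs hψc hfS (fun i => (hFs i).continuous) hFf
    (H := fun i z => (wd Complex.I φ j z * wd Complex.I (F i) k z
          - wd Complex.I φ k z * wd Complex.I (F i) j z) / F i z)
    (B := cj * (2 * K) + ck * (2 * K)) (M := M) (C := C) ?_ ?_ ?_ ?_ ?_ (by positivity) ?_ hM hC ?_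
  · intro i
    refine Measurable.aestronglyMeasurable ?_
    refine Measurable.div (Continuous.measurable ?_) (hFs i).continuous.measurable
    exact ((wd_continuous hφ1).mul (wd_continuous ((hFs i).of_le (by simp)))).sub
      ((wd_continuous hφ1).mul (wd_continuous ((hFs i).of_le (by simp))))
  · intro i z hz
    rw [wd_support (fun h => hz (hsub h)), wd_support (fun h => hz (hsub h))]
    simp
  · filter_upwards [hFl] with z hz hzS h0
    have h1 : Filter.Tendsto (fun i => F i z) Filter.atTop (nhds (f z)) := by
      rw [Metric.tendsto_nhds]
      intro ε hε
      filter_upwards [hFf (ε/2) (by positivity)] with i hi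
      rw [dist_eq_norm]
      linarith [hi z hzS]
    have := ((((hz hzS h0 k).const_mul (wd Complex.I φ j z))).sub
      ((hz hzS h0 j).const_mul (wd Complex.I φ k z))).div h1 h0
    have e : (wd Complex.I φ j z * (A k z * f z) - wd Complex.I φ k z * (A j z * f z)) / f z
        = wd Complex.I φ j z * A k z - wd Complex.I φ k z * A j z := by
      field_simp
    rw [e] at this
    exact this
  · intro z hz
    rw [wd_support (fun h => hz (hsub h)), wd_support (fun h => hz (hsub h))]
    simp
  · intro z hz; simp [hA0 _ z hz]
  · intro ε hε
    filter_upwards [hFA ε hε] with i h1 z hz hzε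
    have hp : 0 < ‖F i z‖ := by linarith
    rw [norm_div, div_le_iff₀ hp]
    refine (norm_sub_le _ _).trans ?_
    rw [norm_mul, norm_mul, add_mul, mul_assoc cj, mul_assoc ck]
    have e1 := h1 z hz hzε j
    have e2 := h1 z hz hzε k
    gcongr
    · exact hbj z
    · exact hbk z
  · intro L hL
    have hε : 0 < M * Real.exp (-L) := by positivity
    filter_upwards [hFA _ hε, hFM] with i h1 h2 η hη hη1
    obtain ⟨g1, g2⟩ := scaled_bounds hM hL (hFs i) h2 h1
    have hε' : ((M * Real.exp (-L) : ℝ) : ℂ) ≠ 0 := by exact_mod_cast hε.ne'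
    have key := hcut (fun z => F i z / ((M * Real.exp (-L) : ℝ) : ℂ)) L
      ((hFs i).div_const _) hL g1 g2 η hη hη1
    refine le_trans (le_of_eq ?_) key
    congr 2
    ext z
    rw [wd_div_const ((hFs i).differentiable (by simp) z),
      wd_div_const ((hFs i).differentiable (by simp) z)]
    set a := ((M * Real.exp (-L) : ℝ) : ℂ)
    by_cases h0 : F i z = 0
    · simp [h0]
    · field_simp

/-! ### Cauchy-Pompeiu -/

lemma cp_radial {G : ℂ → ℂ} (hG : ContDiff ℝ 1 G) (hc : HasCompactSupport G) {e : ℂ} (he : ‖e‖ = 1) :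
    ∫ r in Ioi (0:ℝ), fderiv ℝ G ((r:ℂ) * e) e = - G 0 := by
  obtain ⟨ρ, hρ⟩ := hc.isCompact.isBounded.subset_closedBall (0:ℂ)
  have hd : ∀ r : ℝ, HasDerivAt (fun r : ℝ => G ((r:ℂ) * e)) (fderiv ℝ G ((r:ℂ) * e) e) r := by
    intro r
    have h1 : HasDerivAt (fun r : ℝ => (r:ℂ) * e) (1 * e) r :=
      (Complex.ofRealCLM.hasDerivAt (x := r)).mul_const e
    rw [one_mul] at h1
    exact (hG.differentiable (by norm_num) _).hasFDerivAt.comp_hasDerivAt r h1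
  have hcont : Continuous (fun r : ℝ => fderiv ℝ G ((r:ℂ) * e) e) := by
    have := hG.continuous_fderiv (by norm_num)
    fun_prop
  have hout : ∀ r : ℝ, ρ < r → ((r:ℂ) * e) ∉ tsupport G := by
    intro r hr hm
    have := hρ hm
    simp [he] at this
    linarith [le_abs_self r]
  have hintg : IntegrableOn (fun r : ℝ => fderiv ℝ G ((r:ℂ) * e) e) (Ioi 0) := by
    have h1 : IntegrableOn (fun r : ℝ => fderiv ℝ G ((r:ℂ) * e) e) (Icc 0 (max ρ 0)) :=
      hcont.integrableOn_Icc
    refine h1.of_forall_sdiff_eq_zero measurableSet_Ioi ?_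
    rintro r ⟨hr, hr'⟩
    have : ρ < r := by
      by_contra h
      exact hr' ⟨le_of_lt hr, le_trans (not_lt.1 h) (le_max_left _ _)⟩
    rw [fderiv_of_notMem_tsupport ℝ (hout r this)]
    simp
  have := integral_Ioi_of_hasDerivAt_of_tendsto (a := 0) (f := fun r : ℝ => G ((r:ℂ) * e))
    (m := 0) (hd 0).continuousAt.continuousWithinAt (fun r _ => hd r) hintg ?_
  · simpa using this
  · refine tendsto_const_nhds.congr' ?_
    filter_upwards [Filter.eventually_gt_atTop ρ] with r hr
    exact (image_eq_zero_of_notMem_tsupport (hout r hr)).symm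

lemma cp_angular {G : ℂ → ℂ} (hG : ContDiff ℝ 1 G) {r : ℝ} (hr : 0 < r) :
    ∫ θ in Ioo (-Real.pi) Real.pi, fderiv ℝ G ((r:ℂ) * (Real.cos θ + Real.sin θ * Complex.I))
      (-Real.sin θ + Real.cos θ * Complex.I) = 0 := by
  have hd : ∀ θ : ℝ, HasDerivAt (fun θ : ℝ => G ((r:ℂ) * (Real.cos θ + Real.sin θ * Complex.I)))
      ((r:ℂ) * fderiv ℝ G ((r:ℂ) * (Real.cos θ + Real.sin θ * Complex.I))
        (-Real.sin θ + Real.cos θ * Complex.I)) θ := by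
    intro θ
    have h1 : HasDerivAt (fun θ : ℝ => (r:ℂ) * ((Real.cos θ : ℂ) + Real.sin θ * Complex.I))
        ((r:ℂ) * (((-Real.sin θ : ℝ) : ℂ) + Real.cos θ * Complex.I)) θ :=
      (((Real.hasDerivAt_cos θ).ofReal_comp).add
        ((Real.hasDerivAt_sin θ).ofReal_comp.mul_const Complex.I)).const_mul (r:ℂ)
    have h2 := (hG.differentiable (by norm_num) _).hasFDerivAt.comp_hasDerivAt θ h1
    have h3 : fderiv ℝ G ((r:ℂ) * (Real.cos θ + Real.sin θ * Complex.I))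
        ((r:ℂ) * (((-Real.sin θ : ℝ) : ℂ) + Real.cos θ * Complex.I))
        = (r:ℂ) * fderiv ℝ G ((r:ℂ) * (Real.cos θ + Real.sin θ * Complex.I))
        (-Real.sin θ + Real.cos θ * Complex.I) := by
      generalize fderiv ℝ G ((r:ℂ) * (Real.cos θ + Real.sin θ * Complex.I)) = L
      rw [← Complex.real_smul, ← Complex.real_smul, map_smul]
      simp
      ring
    rw [← h3]
    exact h2
  have hcont : Continuous (fun θ : ℝ => (r:ℂ) * fderiv ℝ G ((r:ℂ) * (Real.cos θ + Real.sin θ * Complex.I))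
        (-Real.sin θ + Real.cos θ * Complex.I)) := by
    have := hG.continuous_fderiv (by norm_num)
    fun_prop
  have := intervalIntegral.integral_eq_sub_of_hasDerivAt (a := -Real.pi) (b := Real.pi)
    (fun θ _ => hd θ) (hcont.intervalIntegrable _ _)
  rw [intervalIntegral.integral_of_le (by linarith [Real.pi_pos]), integral_Ioc_eq_integral_Ioo,
    integral_const_mul] at this
  simp only [Real.cos_neg, Real.sin_neg, Real.cos_pi, Real.sin_pi] at this
  have h2 : (r:ℂ) ≠ 0 := by exact_mod_cast hr.ne'
  simpa [h2] using this

lemma cauchy_pompeiu {G : ℂ → ℂ} (hG : ContDiff ℝ 1 G) (hc : HasCompactSupport G) :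
    ∫ ζ : ℂ, ((Real.pi:ℂ) * ζ)⁻¹ * ((1/2 : ℂ) * (fderiv ℝ G ζ 1 + Complex.I * fderiv ℝ G ζ Complex.I))
      = - G 0 := by
  obtain ⟨ρ, hρ⟩ := hc.isCompact.isBounded.subset_closedBall (0:ℂ)
  let e : ℝ → ℂ := fun θ => Real.cos θ + Real.sin θ * Complex.I
  let F1 : ℝ × ℝ → ℂ := fun p => fderiv ℝ G ((p.1:ℂ) * e p.2) (e p.2)
  let F2 : ℝ × ℝ → ℂ := fun p => fderiv ℝ G ((p.1:ℂ) * e p.2) (-Real.sin p.2 + Real.cos p.2 * Complex.I)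
  have he : ∀ θ, ‖e θ‖ = 1 := fun θ => by
    simp only [e, Complex.ofReal_cos, Complex.ofReal_sin]
    exact Complex.norm_cos_add_sin_mul_I θ
  have hGc := hG.continuous_fderiv (by norm_num)
  have cF1 : Continuous F1 := by simp only [F1, e]; fun_prop
  have cF2 : Continuous F2 := by simp only [F2, e]; fun_prop
  have hz : ∀ p : ℝ × ℝ, ρ < p.1 → fderiv ℝ G ((p.1:ℂ) * e p.2) = 0 := by
    intro p hp
    apply fderiv_of_notMem_tsupport ℝ
    intro hm
    have := hρ hm
    simp [he] at this
    linarith [le_abs_self p.1]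
  have hintg : ∀ F : ℝ × ℝ → ℂ, Continuous F → (∀ p : ℝ × ℝ, ρ < p.1 → F p = 0) →
      IntegrableOn F (Ioi (0:ℝ) ×ˢ Ioo (-Real.pi) Real.pi) := by
    intro F hF h0
    have h1 : IntegrableOn F (Icc 0 (max ρ 0) ×ˢ Icc (-Real.pi) Real.pi) :=
      hF.continuousOn.integrableOn_compact (isCompact_Icc.prod isCompact_Icc)
    refine h1.of_forall_sdiff_eq_zero (measurableSet_Ioi.prod measurableSet_Ioo) ?_
    rintro p ⟨⟨hr, ht⟩, hr'⟩
    apply h0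
    by_contra h
    exact hr' ⟨⟨le_of_lt hr, le_trans (not_lt.1 h) (le_max_left _ _)⟩, Ioo_subset_Icc_self ht⟩
  have i1 := hintg F1 cF1 (fun p hp => by simp [F1, hz p hp])
  have i2 := hintg F2 cF2 (fun p hp => by simp [F2, hz p hp])
  have I1 : ∫ p in Ioi (0:ℝ) ×ˢ Ioo (-Real.pi) Real.pi, F1 p = (2 * Real.pi) * (- G 0) := by
    rw [IntegrableOn, Measure.volume_eq_prod, ← Measure.prod_restrict] at i1
    rw [Measure.volume_eq_prod, ← Measure.prod_restrict, integral_prod_symm _ i1]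
    have : ∀ θ : ℝ, ∫ r in Ioi (0:ℝ), F1 (r, θ) = - G 0 := fun θ => cp_radial hG hc (he θ)
    simp only [this]
    rw [setIntegral_const, measureReal_def, Real.volume_Ioo, ENNReal.toReal_ofReal (by linarith [Real.pi_pos])]
    rw [Complex.real_smul]
    push_cast
    ring
  have I2 : ∫ p in Ioi (0:ℝ) ×ˢ Ioo (-Real.pi) Real.pi, F2 p = 0 := by
    rw [Measure.volume_eq_prod] at i2 ⊢
    rw [setIntegral_prod _ i2]
    rw [setIntegral_congr_fun (g := fun _ => (0:ℂ)) measurableSet_Ioi]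
    · simp
    · intro r hr
      exact cp_angular hG hr
  rw [← Complex.integral_comp_polarCoord_symm]
  have key : ∀ p ∈ Ioi (0:ℝ) ×ˢ Ioo (-Real.pi) Real.pi,
      p.1 • (((Real.pi:ℂ) * Complex.polarCoord.symm p)⁻¹ * ((1/2 : ℂ) *
        (fderiv ℝ G (Complex.polarCoord.symm p) 1 + Complex.I * fderiv ℝ G (Complex.polarCoord.symm p) Complex.I)))
      = (2 * Real.pi : ℂ)⁻¹ * (F1 p + Complex.I * F2 p) := by
    rintro ⟨r, θ⟩ ⟨hr, -⟩
    have hr0 : (r:ℂ) ≠ 0 := by exact_mod_cast (ne_of_gt hr)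
    have hs : Complex.polarCoord.symm (r, θ) = (r:ℂ) * e θ := by simp [e]
    have hpi : (Real.pi:ℂ) ≠ 0 := by exact_mod_cast Real.pi_ne_zero
    have h1 : F1 (r, θ) = Real.cos θ * fderiv ℝ G ((r:ℂ) * e θ) 1
        + Real.sin θ * fderiv ℝ G ((r:ℂ) * e θ) Complex.I := by
      have : e θ = Real.cos θ • (1:ℂ) + Real.sin θ • Complex.I := by simp [e]
      simp only [F1]
      conv_lhs => rw [show fderiv ℝ G (((r, θ) : ℝ × ℝ).1 * e ((r, θ) : ℝ × ℝ).2) (e ((r, θ) : ℝ × ℝ).2) = fderiv ℝ G ((r:ℂ) * e θ) (Real.cos θ • (1:ℂ) + Real.sin θ • Complex.I) from by rw [← this]]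
      rw [map_add, map_smul, map_smul, Complex.real_smul, Complex.real_smul]
    have h2 : F2 (r, θ) = -Real.sin θ * fderiv ℝ G ((r:ℂ) * e θ) 1
        + Real.cos θ * fderiv ℝ G ((r:ℂ) * e θ) Complex.I := by
      have : -(Real.sin θ : ℂ) + Real.cos θ * Complex.I = (-Real.sin θ) • (1:ℂ) + Real.cos θ • Complex.I := by simp
      simp only [F2]
      rw [this, map_add, map_smul, map_smul, Complex.real_smul, Complex.real_smul]
      simp
    have hee : e θ * (Real.cos θ - Real.sin θ * Complex.I) = 1 := by
      simp only [e]
      have : ((Real.cos θ:ℂ))^2 + (Real.sin θ:ℂ)^2 = 1 := by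
        exact_mod_cast Real.cos_sq_add_sin_sq θ
      linear_combination this - (Real.sin θ:ℂ)^2 * Complex.I_sq
    have hei : (e θ)⁻¹ = Real.cos θ - Real.sin θ * Complex.I := inv_eq_of_mul_eq_one_right hee
    rw [hs, h1, h2, Complex.real_smul, mul_inv, mul_inv, hei]
    generalize fderiv ℝ G ((r:ℂ) * e θ) 1 = a
    generalize fderiv ℝ G ((r:ℂ) * e θ) Complex.I = b
    simp only
    field_simp
    linear_combination (- b * Real.sin θ) * Complex.I_sq
  have key2 := setIntegral_congr_fun (μ := volume) (measurableSet_Ioi.prod measurableSet_Ioo) key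
  change ∫ p in Ioi (0:ℝ) ×ˢ Ioo (-Real.pi) Real.pi, _ = _ at *
  rw [key2, integral_const_mul, integral_add i1 (i2.const_mul _), integral_const_mul, I1, I2]
  have hpi : (Real.pi:ℂ) ≠ 0 := by exact_mod_cast Real.pi_ne_zero
  field_simp
  simp

/-! ### The truncated Cauchy kernel -/

def ker (R : ℝ) : ℂ → ℂ := (closedBall (0:ℂ) R).indicator (fun ζ => ((Real.pi:ℂ) * ζ)⁻¹)

lemma ker_measurable (R : ℝ) : Measurable (ker R) :=
  Measurable.indicator (by fun_prop) measurableSet_closedBall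

lemma ker_integrable (R : ℝ) : Integrable (ker R) := by
  have h : Integrable (fun ζ : ℂ => (Iic R).indicator (fun r : ℝ => (Real.pi * r)⁻¹) ‖ζ‖) := by
    rw [integrable_fun_norm_addHaar volume (f := (Iic R).indicator (fun r : ℝ => (Real.pi * r)⁻¹))]
    have h1 : IntegrableOn (fun _ : ℝ => Real.pi⁻¹) (Ioc 0 R) := by simp
    have h2 : IntegrableOn ((Ioc 0 R).indicator (fun _ : ℝ => Real.pi⁻¹)) (Ioi 0) :=
      (h1.integrable_indicator measurableSet_Ioc).integrableOn
    refine h2.congr_fun ?_ measurableSet_Ioi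
    intro r hr
    have hr0 : r ≠ 0 := ne_of_gt hr
    by_cases hR : r ≤ R
    · have : r ∈ Ioc 0 R := ⟨hr, hR⟩
      simp [this, hR, Complex.finrank_real_complex]
      field_simp
    · simp [hR]
  refine h.mono (ker_measurable R).aestronglyMeasurable (Filter.Eventually.of_forall fun ζ => ?_)
  by_cases hR : ‖ζ‖ ≤ R
  · simp [ker, hR]
  · simp [ker, hR]

/-! ### Cauchy transforms in one variable -/

def cau {n : ℕ} (R : ℝ) (j : Fin n) (g : (Fin n → ℂ) → ℂ) (z : Fin n → ℂ) : ℂ :=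
  ∫ ζ, ker R ζ * g (z - Pi.single j ζ)

def caus {n : ℕ} (R : ℝ) (j : Fin n) (φ : (Fin n → ℂ) → ℂ) (w : Fin n → ℂ) : ℂ :=
  ∫ ζ, ker R ζ * φ (w + Pi.single j ζ)

def sgl {n : ℕ} (j : Fin n) : ℂ →L[ℝ] (Fin n → ℂ) := ContinuousLinearMap.single ℝ (fun _ : Fin n => ℂ) j

lemma sgl_apply {n : ℕ} (j : Fin n) (ζ : ℂ) : sgl j ζ = Pi.single j ζ := rfl

lemma single_cont {n : ℕ} (j : Fin n) : Continuous (fun ζ : ℂ => (Pi.single j ζ : Fin n → ℂ)) :=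
  (sgl j).continuous

lemma norm_single' {n : ℕ} (j : Fin n) (ζ : ℂ) : ‖(Pi.single j ζ : Fin n → ℂ)‖ = ‖ζ‖ :=
  Pi.norm_single ..

lemma cau_measurable {n : ℕ} {R : ℝ} {j : Fin n} {g : (Fin n → ℂ) → ℂ} (hg : Measurable g) :
    Measurable (cau R j g) := by
  have h : Measurable (fun p : (Fin n → ℂ) × ℂ => ker R p.2 * g (p.1 - Pi.single j p.2)) := by
    apply ((ker_measurable R).comp measurable_snd).mul
    apply hg.comp
    exact measurable_fst.sub ((single_cont j).measurable.comp measurable_snd)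
  exact (h.stronglyMeasurable.integral_prod_right (ν := volume)).measurable

lemma cau_bound {n : ℕ} {R : ℝ} {j : Fin n} {g : (Fin n → ℂ) → ℂ} {C : ℝ} (hC : ∀ z, ‖g z‖ ≤ C) :
    ∃ C', ∀ z, ‖cau R j g z‖ ≤ C' := by
  refine ⟨∫ ζ, ‖ker R ζ‖ * C, fun z => ?_⟩
  refine norm_integral_le_of_norm_le ((ker_integrable R).norm.mul_const C)
    (Filter.Eventually.of_forall fun ζ => ?_)
  rw [norm_mul]
  exact mul_le_mul_of_nonneg_left (hC _) (norm_nonneg _)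

lemma caus_hasFDerivAt {n : ℕ} {R : ℝ} {j : Fin n} {φ : (Fin n → ℂ) → ℂ}
    (hφ : ContDiff ℝ (⊤ : ℕ∞) φ) (hc : HasCompactSupport φ) (w : Fin n → ℂ) :
    HasFDerivAt (caus R j φ) (∫ ζ, ker R ζ • fderiv ℝ φ (w + Pi.single j ζ)) w := by
  obtain ⟨C, hC⟩ := (hφ.continuous_fderiv (by simp)).bounded_above_of_compact_support (hc.fderiv ℝ)
  obtain ⟨C0, hC0⟩ := hφ.continuous.bounded_above_of_compact_support hc
  have hs := single_cont (n := n) j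
  have hcf := hφ.continuous_fderiv (by simp)
  have hc0 := hφ.continuous
  refine hasFDerivAt_integral_of_dominated_of_fderiv_le (s := univ) (μ := volume) (bound := fun ζ => ‖ker R ζ‖ * C)
    (F := fun w ζ => ker R ζ * φ (w + Pi.single j ζ)) 
    (F' := fun w ζ => ker R ζ • fderiv ℝ φ (w + Pi.single j ζ)) Filter.univ_mem ?_ ?_ ?_ ?_ ?_ ?_
  · refine Filter.Eventually.of_forall fun x => ?_
    exact (ker_measurable R).aestronglyMeasurable.mul
      (Continuous.aestronglyMeasurable (by fun_prop))
  · refine ((ker_integrable R).mul_bdd (c := C0) (Continuous.aestronglyMeasurable (by fun_prop)) (Filter.Eventually.of_forall fun ζ => hC0 _))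
  · exact (ker_measurable R).aestronglyMeasurable.smul
      (Continuous.aestronglyMeasurable (by fun_prop))
  · refine Filter.Eventually.of_forall fun ζ x _ => ?_
    rw [norm_smul]
    exact mul_le_mul_of_nonneg_left (hC _) (norm_nonneg _)
  · exact (ker_integrable R).norm.mul_const C
  · refine Filter.Eventually.of_forall fun ζ x _ => ?_
    have h1 : HasFDerivAt (fun w => φ (w + Pi.single j ζ)) (fderiv ℝ φ (x + Pi.single j ζ)) x := by
      have := ((hφ.differentiable (by simp)) (x + Pi.single j ζ)).hasFDerivAt.comp x ((hasFDerivAt_id x).add_const (Pi.single j ζ))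
      rw [ContinuousLinearMap.comp_id] at this
      exact this
    exact h1.const_mul (ker R ζ)

lemma caus_wd {n : ℕ} {R : ℝ} {c : ℂ} {j k : Fin n} {φ : (Fin n → ℂ) → ℂ}
    (hφ : ContDiff ℝ (⊤ : ℕ∞) φ) (hc : HasCompactSupport φ) (w : Fin n → ℂ) :
    wd c (caus R j φ) k w = caus R j (wd c φ k) w := by
  obtain ⟨C, hC⟩ := (hφ.continuous_fderiv (by simp)).bounded_above_of_compact_support (hc.fderiv ℝ)
  have hs := single_cont (n := n) j
  have hcf := hφ.continuous_fderiv (by simp)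
  have hi : Integrable (fun ζ => ker R ζ • fderiv ℝ φ (w + Pi.single j ζ)) := by
    refine ((ker_integrable R).norm.mul_const C).mono ?_ (Filter.Eventually.of_forall fun ζ => ?_)
    · exact (ker_measurable R).aestronglyMeasurable.smul
        (Continuous.aestronglyMeasurable (by fun_prop))
    · rw [norm_smul]
      refine le_trans (mul_le_mul_of_nonneg_left (hC _) (norm_nonneg _)) (le_abs_self _)
  rw [wd, (caus_hasFDerivAt hφ hc w).fderiv, ContinuousLinearMap.integral_apply hi,
    ContinuousLinearMap.integral_apply hi, ← integral_const_mul, ← integral_add, ← integral_const_mul, caus]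
  · congr 1
    ext ζ
    simp [wd]
    ring
  · exact hi.apply_continuousLinearMap _
  · exact (hi.apply_continuousLinearMap _).const_mul _

lemma caus_contDiff {n : ℕ} {R : ℝ} {j : Fin n} {φ : (Fin n → ℂ) → ℂ}
    (hφ : ContDiff ℝ (⊤ : ℕ∞) φ) (hc : HasCompactSupport φ) :
    ContDiff ℝ (⊤ : ℕ∞) (caus R j φ) := by
  obtain ⟨ρ, hρ⟩ := hc.isCompact.isBounded.subset_closedBall 0
  rw [contDiff_iff_contDiffAt]
  intro w
  have key : ContDiffOn ℝ (⊤ : ℕ∞) (fun x => (convolution (ker R) ((fun p ζ => φ (p - Pi.single j ζ)) x)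
      (ContinuousLinearMap.mul ℝ ℂ) volume) ((fun _ => (0:ℂ)) x)) (ball w 1) := by
    refine contDiffOn_convolution_right_with_param_comp (ContinuousLinearMap.mul ℝ ℂ)
      contDiffOn_const isOpen_ball (isCompact_closedBall (0:ℂ) (‖w‖ + 1 + ρ)) ?_
      (ker_integrable R).locallyIntegrable ?_
    · intro p x hp hx
      apply image_eq_zero_of_notMem_tsupport
      intro hm
      apply hx
      have h1 := hρ hm
      rw [mem_closedBall_zero_iff] at h1 ⊢
      rw [mem_ball_iff_norm] at hp
      have h2 : ‖(Pi.single j x : Fin n → ℂ)‖ = ‖x‖ := norm_single' j x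
      have h3 : ‖(Pi.single j x : Fin n → ℂ)‖ ≤ ‖p - (p - Pi.single j x)‖ := by simp
      have h4 := norm_sub_le p (p - Pi.single j x)
      have h5 : ‖p‖ ≤ ‖p - w‖ + ‖w‖ := by simpa using norm_add_le (p - w) w
      linarith
    · apply ContDiff.contDiffOn
      have : ContDiff ℝ (⊤ : ℕ∞) (fun q : (Fin n → ℂ) × ℂ => φ (q.1 - sgl j q.2)) :=
        hφ.comp (contDiff_fst.sub ((sgl j).contDiff.comp contDiff_snd))
      exact this
  have h2 := key.contDiffAt (ball_mem_nhds w one_pos)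
  convert h2 using 1
  ext x
  simp [caus, convolution, Pi.single_neg]

lemma caus_bound {n : ℕ} {R : ℝ} {j : Fin n} {φ : (Fin n → ℂ) → ℂ} {C : ℝ} (hC : ∀ z, ‖φ z‖ ≤ C) :
    ∃ C', ∀ z, ‖caus R j φ z‖ ≤ C' := by
  refine ⟨∫ ζ, ‖ker R ζ‖ * C, fun z => ?_⟩
  refine norm_integral_le_of_norm_le ((ker_integrable R).norm.mul_const C)
    (Filter.Eventually.of_forall fun ζ => ?_)
  rw [norm_mul]
  exact mul_le_mul_of_nonneg_left (hC _) (norm_nonneg _)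

set_option maxHeartbeats 1000000 in
lemma cau_dual {n : ℕ} {R : ℝ} {j : Fin n} {φ g : (Fin n → ℂ) → ℂ} {C : ℝ} 
    (hφ : Continuous φ) (hc : HasCompactSupport φ) (hg : Measurable g) (hC : ∀ z, ‖g z‖ ≤ C) :
    ∫ z, cau R j g z * φ z = ∫ z, g z * caus R j φ z := by
  have hi : Integrable φ := hφ.integrable_of_hasCompactSupport hc
  have hm : Measurable (fun p : (Fin n → ℂ) × ℂ => g (p.1 - sgl j p.2)) := by
    apply hg.comp
    exact measurable_fst.sub ((sgl j).continuous.measurable.comp measurable_snd)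
  have hI : Integrable (fun p : (Fin n → ℂ) × ℂ => (φ p.1 * ker R p.2) * g (p.1 - sgl j p.2))
      (volume.prod volume) := by
    refine (hi.mul_prod (ker_integrable R)).mul_bdd (c := C) hm.aestronglyMeasurable (Filter.Eventually.of_forall fun p => hC _)
  have hswap := integral_integral_swap (f := fun (z : Fin n → ℂ) (ζ : ℂ) => (φ z * ker R ζ) * g (z - sgl j ζ)) hI
  have h1 : ∀ z, ∫ ζ, (φ z * ker R ζ) * g (z - sgl j ζ) = cau R j g z * φ z := by
    intro z
    rw [cau, mul_comm, ← integral_const_mul]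
    congr 1; ext ζ; rw [sgl_apply]; ring
  have h2 : ∀ ζ, ∫ z, (φ z * ker R ζ) * g (z - sgl j ζ) = ∫ z, g z * (ker R ζ * φ (z + sgl j ζ)) := by
    intro ζ
    rw [← integral_add_right_eq_self _ (sgl j ζ)]
    congr 1; ext z; simp; ring
  simp_rw [h1, h2] at hswap
  rw [hswap]
  have hI2 : Integrable (fun p : ℂ × (Fin n → ℂ) => g p.2 * (ker R p.1 * φ (p.2 + sgl j p.1)))
      (volume.prod volume) := by
    have hmp : MeasurePreserving (fun p : ℂ × (Fin n → ℂ) => (p.1, p.2 + sgl j p.1))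
        (volume.prod volume) (volume.prod volume) := by
      refine MeasurePreserving.skew_product (g := fun (ζ : ℂ) z => z + sgl j ζ)
        (MeasurePreserving.id _) ?_ ?_
      · exact measurable_snd.add ((sgl j).continuous.measurable.comp measurable_fst)
      · exact Filter.Eventually.of_forall fun ζ => (measurePreserving_add_right volume _).map_eq
    have h3 := hmp.integrable_comp_of_integrable ((ker_integrable R).mul_prod hi)
    have := h3.bdd_mul (c := C) (f := fun p : ℂ × (Fin n → ℂ) => g p.2) (hg.comp measurable_snd).aestronglyMeasurable (Filter.Eventually.of_forall fun p => hC _)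
    exact this
  rw [integral_integral_swap (f := fun (ζ : ℂ) (z : Fin n → ℂ) => g z * (ker R ζ * φ (z + sgl j ζ))) hI2]
  congr 1; ext z
  rw [integral_const_mul]
  rfl

lemma caus_wd_self {n : ℕ} {R : ℝ} {j : Fin n} {φ : (Fin n → ℂ) → ℂ}
    (hφ : ContDiff ℝ (⊤ : ℕ∞) φ) (hc : HasCompactSupport φ) {w : Fin n → ℂ}
    (hw : ∀ ζ : ℂ, R < ‖ζ‖ → w + Pi.single j ζ ∉ tsupport φ) :
    wd Complex.I (caus R j φ) j w = - φ w := by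
  rw [caus_wd hφ hc]
  have hG : ContDiff ℝ 1 (fun ζ => φ (w + sgl j ζ)) :=
    (hφ.of_le (by simp)).comp (contDiff_const.add (sgl j).contDiff)
  have hGc : HasCompactSupport (fun ζ => φ (w + sgl j ζ)) := by
    apply HasCompactSupport.intro (isCompact_closedBall (0:ℂ) R)
    intro ζ hζ
    apply image_eq_zero_of_notMem_tsupport
    apply hw
    simpa using hζ
  have h := cauchy_pompeiu hG hGc
  have hd : ∀ ζ v, fderiv ℝ (fun ζ => φ (w + sgl j ζ)) ζ v = fderiv ℝ φ (w + Pi.single j ζ) (Pi.single j v) := by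
    intro ζ v
    have h1 : HasFDerivAt (fun ζ => w + sgl j ζ) (sgl j) ζ := (sgl j).hasFDerivAt.const_add w
    have := ((hφ.differentiable (by simp)) (w + sgl j ζ)).hasFDerivAt.comp ζ h1
    rw [show fderiv ℝ (fun ζ => φ (w + sgl j ζ)) ζ = _ from this.fderiv]
    rfl
  simp only [hd, map_zero, add_zero] at h
  rw [← h, caus]
  congr 1; ext ζ
  by_cases hR : ‖ζ‖ ≤ R
  · simp [ker, hR, wd]
  · rw [wd_support (hw ζ (not_le.1 hR))]
    rw [fderiv_of_notMem_tsupport ℝ (hw ζ (not_le.1 hR))]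
    simp

/-! ### Solving the d-bar equation weakly on a small polydisc -/

/-- Bounded and measurable. -/
def BM {n : ℕ} (g : (Fin n → ℂ) → ℂ) : Prop := Measurable g ∧ ∃ C, ∀ z, ‖g z‖ ≤ C

lemma BM.mul_int {n : ℕ} {g φ : (Fin n → ℂ) → ℂ} (hg : BM g) (hφ : Continuous φ)
    (hc : HasCompactSupport φ) : Integrable (fun z => g z * φ z) := by
  obtain ⟨hm, C, hC⟩ := hg
  exact (hφ.integrable_of_hasCompactSupport hc).bdd_mul (c := C) hm.aestronglyMeasurable
    (Filter.Eventually.of_forall hC)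

lemma BM.add {n : ℕ} {g h : (Fin n → ℂ) → ℂ} (hg : BM g) (hh : BM h) : BM (fun z => g z + h z) := by
  obtain ⟨hm, C, hC⟩ := hg
  obtain ⟨hm', C', hC'⟩ := hh
  exact ⟨hm.add hm', C + C', fun z => (norm_add_le _ _).trans (add_le_add (hC z) (hC' z))⟩

lemma BM.mul {n : ℕ} {g h : (Fin n → ℂ) → ℂ} (hg : BM g) (hh : BM h) : BM (fun z => g z * h z) := by
  obtain ⟨hm, C, hC⟩ := hg
  obtain ⟨hm', C', hC'⟩ := hh
  refine ⟨hm.mul hm', C * C', fun z => ?_⟩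
  rw [norm_mul]
  exact mul_le_mul (hC z) (hC' z) (norm_nonneg _) ((norm_nonneg _).trans (hC z))

lemma BM.cau {n : ℕ} {g : (Fin n → ℂ) → ℂ} (hg : BM g) (R : ℝ) (j : Fin n) : BM (cau R j g) := by
  obtain ⟨hm, C, hC⟩ := hg
  exact ⟨cau_measurable hm, cau_bound hC⟩

/-- weakly closed (0,1)-forms -/
def WC {n : ℕ} (W : Set (Fin n → ℂ)) (B : Fin n → (Fin n → ℂ) → ℂ) : Prop :=
  ∀ φ, IsTestC n W φ → ∀ a b, ∫ z, B b z * wd Complex.I φ a z = ∫ z, B a z * wd Complex.I φ b z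

lemma test_wd {n : ℕ} {W : Set (Fin n → ℂ)} {φ : (Fin n → ℂ) → ℂ} (h : IsTestC n W φ) (a : Fin n) :
    IsTestC n W (wd Complex.I φ a) := by
  refine ⟨wd_contDiff h.1, wd_hcs h.2.1, ?_⟩
  refine subset_trans (closure_minimal ?_ (isClosed_tsupport φ)) h.2.2
  intro z hz
  by_contra hn
  exact hz (wd_support hn)

lemma exists_coord_bump {n : ℕ} (p : Fin n → ℂ) {R : ℝ} (hR : 0 < R) (j : Fin n) :
    ∃ χ : (Fin n → ℂ) → ℂ, ContDiff ℝ (⊤ : ℕ∞) χ ∧ BM χ ∧ BM (wd Complex.I χ j) ∧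
      (∀ k, k ≠ j → ∀ z, wd Complex.I χ k z = 0) ∧ (∀ z, ‖z j - p j‖ ≤ R / 4 → χ z = 1) ∧
      (∀ z, R / 2 < ‖z j - p j‖ → χ z = 0) := by
  let b : ContDiffBump (p j) := ⟨R / 4, R / 2, by positivity, by linarith⟩
  let β : ℂ → ℂ := fun ζ => ((b ζ : ℝ) : ℂ)
  have hβ : ContDiff ℝ (⊤ : ℕ∞) β := Complex.ofRealCLM.contDiff.comp b.contDiff
  have hβc : HasCompactSupport β := b.hasCompactSupport.comp_left (g := fun x : ℝ => (x:ℂ)) (by simp)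
  have hcf := hβ.continuous_fderiv (by simp)
  obtain ⟨C, hC⟩ := hcf.bounded_above_of_compact_support (hβc.fderiv ℝ)
  have hd : ∀ z v : Fin n → ℂ, fderiv ℝ (fun z : Fin n → ℂ => β (z j)) z v = fderiv ℝ β (z j) (v j) := by
    intro z v
    have h1 := ((hβ.differentiable (by simp)) (z j)).hasFDerivAt.comp z (hasFDerivAt_apply (𝕜 := ℝ) j z)
    rw [show fderiv ℝ (fun z : Fin n → ℂ => β (z j)) z = _ from h1.fderiv]
    rfl
  refine ⟨fun z => β (z j), ?_, ⟨?_, 1, ?_⟩, ⟨?_, C, ?_⟩, ?_, ?_, ?_⟩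
  · exact hβ.comp (contDiff_apply ℝ ℂ j)
  · exact (hβ.continuous.comp (continuous_apply j)).measurable
  · intro z
    simp only [β, Complex.norm_real, Real.norm_eq_abs, abs_of_nonneg b.nonneg]
    exact b.le_one
  · unfold wd
    simp only [hd]
    apply Continuous.measurable
    fun_prop
  · intro z
    simp only [wd, hd, Pi.single_eq_same]
    have h1 := (fderiv ℝ β (z j)).le_opNorm 1
    have h2 := (fderiv ℝ β (z j)).le_opNorm Complex.I
    have h3 := hC (z j)
    have h4 := norm_add_le (fderiv ℝ β (z j) 1) (Complex.I * fderiv ℝ β (z j) Complex.I)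
    rw [norm_mul, Complex.norm_I, one_mul] at h4
    simp only [norm_one, Complex.norm_I, mul_one] at h1 h2
    rw [norm_mul]
    norm_num
    linarith
  · intro k hk z
    simp only [wd, hd, Pi.single_eq_of_ne hk.symm]
    simp
  · intro z hz
    have : b (z j) = 1 := b.one_of_mem_closedBall (by rw [mem_closedBall_iff_norm]; exact hz)
    simp [β, this]
  · intro z hz
    have : b (z j) = 0 := b.zero_of_le_dist (by rw [dist_eq_norm]; exact hz.le)
    simp [β, this]

lemma solve_step {n : ℕ} (p : Fin n → ℂ) {R : ℝ} (hR : 0 < R) (j : Fin n)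
    {B : Fin n → (Fin n → ℂ) → ℂ} (hB : ∀ k, BM (B k)) (hBc : WC (ball p R) B) :
    ∃ (v : (Fin n → ℂ) → ℂ) (B' : Fin n → (Fin n → ℂ) → ℂ), BM v ∧ (∀ k, BM (B' k)) ∧
      (∀ z, B' j z = 0) ∧ (∀ k, (∀ z, B k z = 0) → ∀ z, B' k z = 0) ∧
      ∀ φ, IsTestC n (ball p (R / 4)) φ → ∀ k,
        ∫ z, v z * wd Complex.I φ k z = - (∫ z, B k z * φ z) + ∫ z, B' k z * φ z := by
  classical
  obtain ⟨χ, hχ, hχb, hχdb, hχk, hχ1, hχ0⟩ := exists_coord_bump p hR j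
  refine ⟨cau R j (fun z => χ z * B j z),
    fun k => if k = j then fun _ => 0 else cau R j (fun z => B k z * wd Complex.I χ j z),
    (hχb.mul (hB j)).cau R j, ?_, ?_, ?_, ?_⟩
  · intro k
    by_cases hk : k = j
    · simp only [hk, if_true]
      exact ⟨measurable_const, 0, by simp⟩
    · simp only [hk, if_false]
      exact ((hB k).mul hχdb).cau R j
  · simp
  · intro k hk z
    by_cases h : k = j
    · simp [h]
    · simp [h, cau, hk]
  · intro φ hφ k
    have hball : ∀ w ∈ tsupport φ, ∀ i, ‖w i - p i‖ < R / 4 := by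
      intro w hw i
      have h1 := hφ.2.2 hw
      rw [mem_ball_iff_norm] at h1
      exact lt_of_le_of_lt (norm_le_pi_norm (w - p) i) h1
    have hself : ∀ w : Fin n → ℂ, ‖w j - p j‖ ≤ R / 2 → wd Complex.I (caus R j φ) j w = - φ w := by
      intro w hw
      apply caus_wd_self hφ.1 hφ.2.1
      intro ζ hζ hm
      have h1 := hball _ hm j
      simp only [Pi.add_apply, Pi.single_eq_same] at h1
      have h2 : ‖ζ‖ ≤ ‖w j + ζ - p j‖ + ‖w j - p j‖ := by
        have := norm_sub_le (w j + ζ - p j) (w j - p j)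
        rwa [show w j + ζ - p j - (w j - p j) = ζ by ring] at this
      linarith
    have hχφ : ∀ z, χ z * φ z = φ z := by
      intro z
      by_cases hz : z ∈ tsupport φ
      · rw [hχ1 z (hball z hz j).le, one_mul]
      · rw [image_eq_zero_of_notMem_tsupport hz, mul_zero]
    have hχθ : ∀ z, χ z * wd Complex.I (caus R j φ) j z = - φ z := by
      intro z
      by_cases hz : ‖z j - p j‖ ≤ R / 2
      · rw [hself z hz, mul_neg, hχφ]
      · rw [← hχφ, hχ0 z (not_le.1 hz)]; simp
    have hdual : ∫ z, cau R j (fun z => χ z * B j z) z * wd Complex.I φ k z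
        = ∫ z, B j z * (χ z * wd Complex.I (caus R j φ) k z) := by
      obtain ⟨hm, C, hC⟩ := hχb.mul (hB j)
      rw [cau_dual (wd_contDiff hφ.1).continuous (wd_hcs hφ.2.1) hm hC]
      congr 1; ext z
      rw [caus_wd hφ.1 hφ.2.1]; ring
    rw [hdual]
    by_cases hk : k = j
    · subst hk
      simp only [hχθ, if_true]
      simp [integral_neg]
    · simp only [hk, if_false]
      have hθ : ContDiff ℝ (⊤ : ℕ∞) (caus R j φ) := caus_contDiff hφ.1 hφ.2.1
      have hsupp : tsupport (fun z => χ z * caus R j φ z) ⊆ closedBall p (R / 2) := by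
        refine closure_minimal ?_ isClosed_closedBall
        intro z hz
        have hz1 : χ z ≠ 0 := left_ne_zero_of_mul hz
        have hz2 : caus R j φ z ≠ 0 := right_ne_zero_of_mul hz
        rw [mem_closedBall_iff_norm, pi_norm_le_iff_of_nonneg (by positivity)]
        intro i
        by_cases hi : i = j
        · subst hi
          by_contra h
          exact hz1 (hχ0 z (not_le.1 h))
        · by_contra h
          apply hz2
          unfold caus
          apply integral_eq_zero_of_ae
          refine Filter.Eventually.of_forall fun ζ => ?_
          have : z + Pi.single j ζ ∉ tsupport φ := by
            intro hm
            have h1 := hball _ hm i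
            simp only [Pi.add_apply, Pi.single_eq_of_ne hi, add_zero] at h1
            apply h
            rw [Pi.sub_apply]
            linarith
          simp [image_eq_zero_of_notMem_tsupport this]
      have htest : IsTestC n (ball p R) (fun z => χ z * caus R j φ z) :=
        ⟨hχ.mul hθ, HasCompactSupport.of_support_subset_isCompact (isCompact_closedBall p (R / 2))
          (subset_trans (subset_tsupport _) hsupp),
          hsupp.trans (closedBall_subset_ball (by linarith))⟩
      have hw : ∀ k z, wd Complex.I (fun z => χ z * caus R j φ z) k z
          = wd Complex.I χ k z * caus R j φ z + χ z * wd Complex.I (caus R j φ) k z := fun k z =>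
        wd_mul (hχ.differentiable (by simp) z) (hθ.differentiable (by simp) z)
      have h1 := hBc _ htest k j
      simp only [hw, hχk k hk, zero_mul, zero_add, hχθ] at h1
      rw [h1]
      obtain ⟨hm, C, hC⟩ := (hB k).mul hχdb
      rw [cau_dual hφ.1.continuous hφ.2.1 hm hC]
      have i2 : Integrable (fun z => B k z * φ z) := (hB k).mul_int hφ.1.continuous hφ.2.1
      have i1 : Integrable (fun z => B k z * (wd Complex.I χ j z * caus R j φ z + -φ z)) := by
        have := (hB k).mul_int (test_wd htest j).1.continuous (test_wd htest j).2.1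
        simpa only [hw, hχθ] using this
      have e : ∀ z, B k z * wd Complex.I χ j z * caus R j φ z = B k z * (wd Complex.I χ j z * caus R j φ z + -φ z) + B k z * φ z := fun z => by ring
      simp only [e]
      rw [integral_add i1 i2]
      ring

lemma weak_solve {n : ℕ} (p : Fin n → ℂ) {R : ℝ} (hR : 0 < R)
    {A : Fin n → (Fin n → ℂ) → ℂ} (hA : ∀ k, BM (A k)) (hAc : WC (ball p R) A) :
    ∃ R' > 0, R' ≤ R ∧ ∃ u : (Fin n → ℂ) → ℂ, BM u ∧
      ∀ φ, IsTestC n (ball p R') φ → ∀ k,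
        ∫ z, u z * wd Complex.I φ k z = - ∫ z, A k z * φ z := by
  classical
  have key : ∀ S : Finset (Fin n), ∃ R' > 0, R' ≤ R ∧ ∃ (u : (Fin n → ℂ) → ℂ)
      (B : Fin n → (Fin n → ℂ) → ℂ), BM u ∧ (∀ k, BM (B k)) ∧ WC (ball p R') B ∧
      (∀ k ∈ S, ∀ z, B k z = 0) ∧ ∀ φ, IsTestC n (ball p R') φ → ∀ k,
        ∫ z, u z * wd Complex.I φ k z = - (∫ z, A k z * φ z) + ∫ z, B k z * φ z := by
    intro S
    induction S using Finset.induction_on with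
    | empty =>
      refine ⟨R, hR, le_rfl, fun _ => 0, A, ⟨measurable_const, 0, by simp⟩, hA, hAc, by simp, ?_⟩
      intro φ _ k
      simp
    | insert j S _ ih =>
      obtain ⟨R₁, hR₁, hle, u, B, hu, hB, hBc, hB0, hw⟩ := ih
      obtain ⟨v, B', hv, hB', hB'j, hB'0, hvw⟩ := solve_step p hR₁ j hB hBc
      have hmono : ∀ φ, IsTestC n (ball p (R₁ / 4)) φ → IsTestC n (ball p R₁) φ := fun φ h =>
        ⟨h.1, h.2.1, h.2.2.trans (ball_subset_ball (by linarith))⟩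
      refine ⟨R₁ / 4, by positivity, by linarith, fun z => u z + v z, B', hu.add hv, hB', ?_, ?_, ?_⟩
      · intro φ hφ a b
        have h1 := hvw _ (test_wd hφ a) b
        have h2 := hvw _ (test_wd hφ b) a
        have h3 := hBc _ (hmono _ hφ) a b
        have h4 : ∀ z, wd Complex.I (wd Complex.I φ a) b z = wd Complex.I (wd Complex.I φ b) a z :=
          wd_comm (contDiff_infty.1 hφ.1 2)
        simp only [h4] at h1
        rw [h1] at h2
        linear_combination h2 + h3
      · intro k hk
        rcases Finset.mem_insert.1 hk with rfl | hk
        · exact hB'j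
        · exact hB'0 k (hB0 k hk)
      · intro φ hφ k
        have h1 := hvw _ hφ k
        have h2 := hw _ (hmono _ hφ) k
        have hc := (test_wd hφ k)
        simp only [add_mul]
        rw [integral_add (hu.mul_int hc.1.continuous hc.2.1) (hv.mul_int hc.1.continuous hc.2.1),
          h1, h2]
        ring
  obtain ⟨R', hR', hle, u, B, hu, -, -, hB0, hw⟩ := key Finset.univ
  refine ⟨R', hR', hle, u, hu, fun φ hφ k => ?_⟩
  rw [hw φ hφ k]
  simp [hB0 k (Finset.mem_univ k)]

/-! ### Weyl's lemma for bounded functions -/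

lemma BM.locInt {n : ℕ} {g : (Fin n → ℂ) → ℂ} (hg : BM g) : LocallyIntegrable g := by
  obtain ⟨hm, C, hC⟩ := hg
  refine (locallyIntegrable_const (C : ℝ)).mono hm.aestronglyMeasurable
    (Filter.Eventually.of_forall fun z => ?_)
  exact (hC z).trans (le_abs_self _)

lemma BM.mol_le {n : ℕ} {g : (Fin n → ℂ) → ℂ} (hg : BM g) : ∃ C, 0 ≤ C ∧ ∀ i x, ‖mol i g x‖ ≤ C := by
  obtain ⟨hm, C, hC⟩ := hg
  have h0 : 0 ≤ C := (norm_nonneg _).trans (hC 0)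
  exact ⟨C, h0, fun i x => mol_bound hm.aestronglyMeasurable h0 fun t _ => hC t⟩

lemma holo_of_wd {n : ℕ} {F : (Fin n → ℂ) → ℂ} {x : Fin n → ℂ} (hF : DifferentiableAt ℝ F x)
    (h : ∀ j, wd Complex.I F j x = 0) : DifferentiableAt ℂ F x := by
  rw [differentiableAt_iff_restrictScalars ℝ hF]
  have h1 : ∀ j, fderiv ℝ F x (Pi.single j Complex.I) = Complex.I * fderiv ℝ F x (Pi.single j 1) := by
    intro j
    have := h j
    unfold wd at this
    have h2 : fderiv ℝ F x (Pi.single j 1) + Complex.I * fderiv ℝ F x (Pi.single j Complex.I) = 0 := by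
      simpa using this
    linear_combination (-Complex.I) * h2 + (fderiv ℝ F x (Pi.single j Complex.I)) * Complex.I_sq
  have h3 : ∀ j ζ, fderiv ℝ F x (Pi.single j ζ) = ζ * fderiv ℝ F x (Pi.single j 1) := by
    intro j ζ
    have e : (Pi.single j ζ : Fin n → ℂ) = ζ.re • (Pi.single j 1 : Fin n → ℂ) +
        ζ.im • (Pi.single j Complex.I : Fin n → ℂ) := by
      rw [← Pi.single_smul, ← Pi.single_smul, ← Pi.single_add]
      congr 1
      simp
    rw [e, map_add, map_smul, map_smul, h1, Complex.real_smul, Complex.real_smul]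
    conv_rhs => rw [← Complex.re_add_im ζ]
    ring
  refine ⟨∑ j, (ContinuousLinearMap.proj (R := ℂ) (φ := fun _ : Fin n => ℂ) j).smulRight
    (fderiv ℝ F x (Pi.single j 1)), ?_⟩
  ext v
  conv_rhs => rw [← Finset.univ_sum_single v, map_sum]
  rw [Finset.sum_congr rfl (fun j _ => h3 j (v j))]
  simp

lemma fderiv_bound {n : ℕ} {F : (Fin n → ℂ) → ℂ} {x : Fin n → ℂ} {ρ M : ℝ} (hρ : 0 < ρ)
    (hd : DifferentiableOn ℂ F (ball x ρ)) (hM : ∀ z ∈ ball x ρ, ‖F z‖ ≤ M) :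
    ‖fderiv ℂ F x‖ ≤ 2 * M / ρ := by
  refine Complex.norm_fderiv_le_div_of_mapsTo_ball hd ?_ hρ
  intro z hz
  rw [mem_closedBall_iff_norm]
  have := norm_sub_le (F z) (F x)
  linarith [hM z hz, hM x (mem_ball_self hρ)]

lemma ae_exists_near {n : ℕ} {P : (Fin n → ℂ) → Prop} (h : ∀ᵐ z, P z) (x : Fin n → ℂ) {δ : ℝ}
    (hδ : 0 < δ) : ∃ y ∈ ball x δ, P y := by
  have : Dense {z | P z} := Measure.dense_of_ae h
  obtain ⟨y, hy, hyd⟩ := this.exists_dist_lt x hδ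
  exact ⟨y, by rwa [mem_ball, dist_comm], hy⟩

lemma holo_limit {n : ℕ} {H : ℕ → (Fin n → ℂ) → ℂ} {h : (Fin n → ℂ) → ℂ} {p : Fin n → ℂ} {r C : ℝ}
    (hr : 0 < r) (hC : 0 ≤ C) (hd : ∀ i, DifferentiableOn ℂ (H i) (ball p (4 * r)))
    (hb : ∀ i z, ‖H i z‖ ≤ C)
    (hae : ∀ᵐ z, Filter.Tendsto (fun i => H i z) Filter.atTop (nhds (h z))) :
    ∃ g : (Fin n → ℂ) → ℂ, DifferentiableOn ℂ g (ball p r) ∧ ∀ᵐ z, z ∈ ball p r → g z = h z := by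
  have hsub : ∀ {a b : ℝ} {x : Fin n → ℂ}, x ∈ ball p a → a + r ≤ b → ball x r ⊆ ball p b := by
    intro a b x hx hab
    apply ball_subset_ball'
    rw [mem_ball] at hx
    linarith
  set L : ℝ := 2 * C / r with hL
  have hL0 : 0 ≤ L := by positivity
  have hlip : ∀ i, ∀ x ∈ ball p (3 * r), ∀ y ∈ ball p (3 * r), ‖H i y - H i x‖ ≤ L * ‖y - x‖ := by
    intro i x hx y hy
    refine (convex_ball p (3 * r)).norm_image_sub_le_of_norm_fderiv_le (𝕜 := ℂ) ?_ ?_ hx hy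
    · intro z hz
      exact (hd i).differentiableAt (isOpen_ball.mem_nhds (ball_subset_ball (by linarith) hz))
    · intro z hz
      exact fderiv_bound hr ((hd i).mono (hsub hz (by linarith))) (fun w _ => hb i w)
  have hUC : UniformCauchySeqOn H Filter.atTop (closedBall p (2 * r)) := by
    rw [Metric.uniformCauchySeqOn_iff]
    intro ε hε
    obtain ⟨δ, hδ, hδr, hδL⟩ : ∃ δ > 0, δ ≤ r / 2 ∧ L * (2 * δ) ≤ ε / 4 := by
      refine ⟨min (r / 2) (ε / (8 * (L + 1))), by positivity, min_le_left _ _, ?_⟩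
      have h1 : min (r / 2) (ε / (8 * (L + 1))) ≤ ε / (8 * (L + 1)) := min_le_right _ _
      have h2 : ε / (8 * (L + 1)) * (8 * (L + 1)) = ε := by field_simp
      have h3 : 0 < min (r / 2) (ε / (8 * (L + 1))) := by positivity
      nlinarith
    choose y hy hyt using fun x => ae_exists_near hae x hδ
    obtain ⟨t, ht, hcov⟩ := (isCompact_closedBall p (2 * r)).elim_nhds_subcover (fun x => ball x δ)
      (fun x _ => ball_mem_nhds x hδ)
    have hev : ∀ᶠ N in Filter.atTop, ∀ x ∈ t, ∀ m ≥ N, ‖H m (y x) - h (y x)‖ < ε / 8 := by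
      rw [Filter.eventually_all_finset]
      intro x _
      have h1 := (Metric.tendsto_atTop.1 (hyt x)) (ε / 8) (by positivity)
      obtain ⟨N, hN⟩ := h1
      filter_upwards [Filter.eventually_ge_atTop N] with N' hN' m hm
      rw [← dist_eq_norm]
      exact hN m (le_trans hN' hm)
    obtain ⟨N, hN⟩ := hev.exists
    refine ⟨N, fun m hm k hk z hz => ?_⟩
    obtain ⟨x, hxt, hzx⟩ := mem_iUnion₂.1 (hcov hz)
    have hyx := hy x
    have hx2 := ht x hxt
    rw [mem_ball] at hzx hyx
    rw [mem_closedBall] at hz hx2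
    have hz3 : z ∈ ball p (3 * r) := by rw [mem_ball]; linarith
    have hy3 : y x ∈ ball p (3 * r) := by
      rw [mem_ball]
      have := dist_triangle (y x) x p
      linarith
    have hzy : ‖z - y x‖ ≤ 2 * δ := by
      rw [← dist_eq_norm]
      have := dist_triangle z x (y x)
      rw [dist_comm x] at this
      linarith
    have l1 := (hlip m _ hy3 _ hz3).trans (mul_le_mul_of_nonneg_left hzy hL0)
    have l2 := (hlip k _ hy3 _ hz3).trans (mul_le_mul_of_nonneg_left hzy hL0)
    have l3 := hN x hxt m hm
    have l4 := hN x hxt k hk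
    rw [dist_eq_norm]
    have e : H m z - H k z = (H m z - H m (y x)) - (H k z - H k (y x)) + (H m (y x) - h (y x)) - (H k (y x) - h (y x)) := by ring
    rw [e]
    have n1 := norm_sub_le ((H m z - H m (y x)) - (H k z - H k (y x)) + (H m (y x) - h (y x))) (H k (y x) - h (y x))
    have n2 := norm_add_le ((H m z - H m (y x)) - (H k z - H k (y x))) (H m (y x) - h (y x))
    have n3 := norm_sub_le (H m z - H m (y x)) (H k z - H k (y x))
    linarith
  have hUD : UniformCauchySeqOn (fun i => fderiv ℂ (H i)) Filter.atTop (ball p r) := by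
    rw [Metric.uniformCauchySeqOn_iff] at hUC ⊢
    intro ε hε
    obtain ⟨N, hN⟩ := hUC (ε * r / 4) (by positivity)
    refine ⟨N, fun m hm k hk x hx => ?_⟩
    have hxn : ball p (4 * r) ∈ nhds x := isOpen_ball.mem_nhds (ball_subset_ball (by linarith) hx)
    have hs := hsub hx (b := 2 * r) (by linarith)
    have hs4 : ball x r ⊆ ball p (4 * r) := hs.trans (ball_subset_ball (by linarith))
    have h1 := fderiv_bound (F := fun z => H m z - H k z) (M := ε * r / 4) hr
      (((hd m).mono hs4).sub ((hd k).mono hs4)) (fun z hz => by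
        have := hN m hm k hk z (ball_subset_closedBall (hs hz))
        rw [dist_eq_norm] at this
        exact this.le)
    rw [fderiv_fun_sub ((hd m).differentiableAt hxn) ((hd k).differentiableAt hxn)] at h1
    rw [dist_eq_norm]
    have e : 2 * (ε * r / 4) / r = ε / 2 := by field_simp; norm_num
    rw [e] at h1
    linarith
  have hg' : ∀ x, ∃ a, x ∈ ball p r → Filter.Tendsto (fun i => H i x) Filter.atTop (nhds a) := by
    intro x
    by_cases hx : x ∈ ball p r
    · obtain ⟨a, ha⟩ := cauchySeq_tendsto_of_complete
        (hUC.cauchySeq (ball_subset_closedBall (ball_subset_ball (by linarith) hx)))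
      exact ⟨a, fun _ => ha⟩
    · exact ⟨0, fun h => absurd h hx⟩
  have hG' : ∀ x, ∃ a, x ∈ ball p r → Filter.Tendsto (fun i => fderiv ℂ (H i) x)
      Filter.atTop (nhds a) := by
    intro x
    by_cases hx : x ∈ ball p r
    · obtain ⟨a, ha⟩ := cauchySeq_tendsto_of_complete (hUD.cauchySeq hx)
      exact ⟨a, fun _ => ha⟩
    · exact ⟨0, fun h => absurd h hx⟩
  choose g hg using hg'
  choose G hG using hG'
  have hT := hUD.tendstoUniformlyOn_of_tendsto hG
  refine ⟨g, ?_, ?_⟩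
  · intro x hx
    have := hasFDerivAt_of_tendstoUniformlyOn isOpen_ball hT (f := H) (fun i z hz =>
      ((hd i).differentiableAt (isOpen_ball.mem_nhds (ball_subset_ball (by linarith) hz))).hasFDerivAt)
      hg hx
    exact this.differentiableAt.differentiableWithinAt
  · filter_upwards [hae] with z hz hzb
    exact tendsto_nhds_unique (hg z hzb) hz

lemma mo_test {n i : ℕ} {W : Set (Fin n → ℂ)} {x : Fin n → ℂ}
    (h : closedBall x (1 / ((i:ℝ) + 1)) ⊆ W) : IsTestC n W (fun t => mo n i (x - t)) :=
  ⟨mo_sub_contDiff x, mo_sub_hcs x, (mo_sub_tsupport x).trans h⟩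

lemma weyl {n : ℕ} {h : (Fin n → ℂ) → ℂ} {p : Fin n → ℂ} {R : ℝ} (hR : 0 < R) (hh : BM h)
    (hw : ∀ φ, IsTestC n (ball p R) φ → ∀ j, ∫ z, h z * wd Complex.I φ j z = 0) :
    ∃ g : (Fin n → ℂ) → ℂ, DifferentiableOn ℂ g (ball p (R / 8)) ∧
      ∀ᵐ z, z ∈ ball p (R / 8) → g z = h z := by
  obtain ⟨C, hC0, hC⟩ := hh.mol_le
  obtain ⟨N, hN⟩ := exists_nat_one_div_lt (show 0 < R / 2 by positivity)
  refine holo_limit (H := fun i => mol (i + N) h) (C := C) (by positivity) hC0 ?_ (fun i z => hC _ z) ?_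
  · intro i x hx
    apply DifferentiableAt.differentiableWithinAt
    apply holo_of_wd ((mol_contDiff hh.locInt).differentiable (by simp) x)
    intro j
    rw [mol_wd hh.locInt, hw _ (mo_test ?_), neg_zero]
    apply closedBall_subset_ball'
    rw [mem_ball] at hx
    have : 1 / (((i + N : ℕ):ℝ) + 1) ≤ 1 / ((N:ℝ) + 1) := by
      apply one_div_le_one_div_of_le (by positivity)
      push_cast
      linarith [Nat.cast_nonneg (α := ℝ) i]
    linarith
  · filter_upwards [mol_ae hh.locInt] with z hz
    exact hz.comp (Filter.tendsto_add_atTop_nat N)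

/-! ### The integrating factor, and the conclusion -/

lemma wd_exp {n : ℕ} {c : ℂ} {g : (Fin n → ℂ) → ℂ} {j : Fin n} {z : Fin n → ℂ}
    (hg : DifferentiableAt ℝ g z) :
    wd c (fun w => Complex.exp (-g w)) j z = - Complex.exp (-g z) * wd c g j z := by
  have h : HasFDerivAt (fun w => Complex.exp (-g w)) (Complex.exp (-g z) • (-fderiv ℝ g z)) z :=
    hg.hasFDerivAt.neg.cexp
  unfold wd
  rw [h.fderiv]
  simp
  ring

lemma norm_exp_neg_le {w : ℂ} {C : ℝ} (h : ‖w‖ ≤ C) : ‖Complex.exp (-w)‖ ≤ Real.exp C := by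
  rw [Complex.norm_exp]
  apply Real.exp_le_exp.2
  have := Complex.re_le_norm (-w)
  rw [norm_neg] at this
  linarith

lemma BM.exp_neg {n : ℕ} {u : (Fin n → ℂ) → ℂ} (hu : BM u) : BM (fun z => Complex.exp (-u z)) := by
  obtain ⟨hm, C, hC⟩ := hu
  exact ⟨Complex.measurable_exp.comp hm.neg, Real.exp C, fun z => norm_exp_neg_le (hC z)⟩

lemma twist {n : ℕ} {W : Set (Fin n → ℂ)} (hW : IsOpen W) {F u B : (Fin n → ℂ) → ℂ} {j : Fin n}
    (hF : BM F) (hu : BM u) (hB : BM B)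
    (h1 : ∀ φ, IsTestC n W φ → ∫ z, (F z * wd Complex.I φ j z + B z * F z * φ z) = 0)
    (h2 : ∀ φ, IsTestC n W φ → ∫ z, u z * wd Complex.I φ j z = - ∫ z, B z * φ z)
    {φ : (Fin n → ℂ) → ℂ} (hφ : IsTestC n W φ) :
    ∫ z, F z * Complex.exp (-u z) * wd Complex.I φ j z = 0 := by
  obtain ⟨r, hr, -, -, -, -, -, -, -, hrW⟩ := exists_cutoff hW hφ.2.1 hφ.2.2
  obtain ⟨N, hN⟩ := exists_nat_one_div_lt hr
  have hφ1 : ContDiff ℝ 1 φ := hφ.1.of_le (by simp)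
  have hus : ∀ i, ContDiff ℝ (⊤ : ℕ∞) (mol i u) := fun i => mol_contDiff hu.locInt
  have key : ∀ i ≥ N, ∀ x, wd Complex.I (mol i u) j x * φ x = mol i B x * φ x := by
    intro i hi x
    by_cases hx : x ∈ tsupport φ
    · congr 1
      rw [mol_wd hu.locInt, h2 _ (mo_test ?_), neg_neg]
      · rfl
      · refine subset_trans ?_ hrW
        refine (closedBall_subset_closedBall ?_).trans (closedBall_subset_cthickening hx r)
        have : 1 / ((i:ℝ) + 1) ≤ 1 / ((N:ℝ) + 1) := by
          apply one_div_le_one_div_of_le (by positivity)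
          have : (N:ℝ) ≤ i := by exact_mod_cast hi
          linarith
        linarith
    · rw [image_eq_zero_of_notMem_tsupport hx]; simp
  have hz : ∀ i ≥ N, ∫ z, F z * Complex.exp (-mol i u z) *
      (wd Complex.I φ j z + (B z - mol i B z) * φ z) = 0 := by
    intro i hi
    have hes : ContDiff ℝ (⊤ : ℕ∞) (fun z => Complex.exp (-mol i u z)) := (hus i).neg.cexp
    have ht : IsTestC n W (fun z => Complex.exp (-mol i u z) * φ z) :=
      ⟨hes.mul hφ.1, hφ.2.1.mul_left, (tsupport_mul_subset_right).trans hφ.2.2⟩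
    rw [← h1 _ ht]
    congr 1
    ext z
    rw [wd_mul (hes.differentiable (by simp) z) (hφ1.differentiable (by simp) z),
      wd_exp ((hus i).differentiable (by simp) z)]
    linear_combination (F z * Complex.exp (-mol i u z)) * key i hi z
  obtain ⟨CB, hCB0, hCB⟩ := hB.mol_le
  obtain ⟨Cu, hCu0, hCu⟩ := hu.mol_le
  obtain ⟨hFm, CF, hCF⟩ := id hF
  obtain ⟨hBm, CB', hCB'⟩ := id hB
  have hCF0 : 0 ≤ CF := (norm_nonneg _).trans (hCF 0)
  have hlim : Filter.Tendsto (fun i : ℕ => ∫ z, F z * Complex.exp (-mol i u z) *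
      (wd Complex.I φ j z + (B z - mol i B z) * φ z)) Filter.atTop
      (nhds (∫ z, F z * Complex.exp (-u z) * wd Complex.I φ j z)) := by
    refine tendsto_integral_of_dominated_convergence
      (fun z => CF * Real.exp Cu * (‖wd Complex.I φ j z‖ + (CB' + CB) * ‖φ z‖)) ?_ ?_ ?_ ?_
    · intro i
      refine Measurable.aestronglyMeasurable ?_
      have a1 := (hus i).continuous.measurable
      have a2 : Measurable (mol i B) := (mol_contDiff hB.locInt).continuous.measurable
      have a3 := (wd_continuous (c := Complex.I) (j := j) hφ1).measurable
      have a4 := hφ1.continuous.measurable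
      exact (hFm.mul (Complex.measurable_exp.comp a1.neg)).mul (a3.add ((hBm.sub a2).mul a4))
    · refine Integrable.const_mul (Integrable.add ?_ (Integrable.const_mul ?_ _)) _
      · exact ((wd_continuous hφ1).integrable_of_hasCompactSupport (wd_hcs hφ.2.1)).norm
      · exact (hφ1.continuous.integrable_of_hasCompactSupport hφ.2.1).norm
    · intro i
      refine Filter.Eventually.of_forall fun z => ?_
      rw [norm_mul, norm_mul]
      refine mul_le_mul (mul_le_mul (hCF z) (norm_exp_neg_le (hCu i z)) (norm_nonneg _) hCF0) ?_
        (norm_nonneg _) (by positivity)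
      refine (norm_add_le _ _).trans (add_le_add le_rfl ?_)
      rw [norm_mul]
      refine mul_le_mul_of_nonneg_right ?_ (norm_nonneg _)
      exact (norm_sub_le _ _).trans (add_le_add (hCB' z) (hCB i z))
    · filter_upwards [mol_ae hu.locInt, mol_ae hB.locInt] with z hzu hzB
      have e1 : Filter.Tendsto (fun i => Complex.exp (-mol i u z)) Filter.atTop
          (nhds (Complex.exp (-u z))) := (Complex.continuous_exp.tendsto _).comp hzu.neg
      have e2 := (((hzB.const_sub (B z)).mul_const (φ z)).const_add (wd Complex.I φ j z))
      have := (e1.const_mul (F z)).mul e2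
      simpa using this
  refine tendsto_nhds_unique hlim (tendsto_const_nhds.congr' ?_)
  filter_upwards [Filter.eventually_ge_atTop N] with i hi
  exact (hz i hi).symm

lemma zero_iff_of_ae {n : ℕ} {V : Set (Fin n → ℂ)} (hV : IsOpen V) {a b : (Fin n → ℂ) → ℂ}
    (ha : ContinuousOn a V) (hb : ContinuousOn b V) {M : ℝ}
    (h : ∀ᵐ z, z ∈ V → ‖a z‖ ≤ M * ‖b z‖) {x : Fin n → ℂ} (hx : x ∈ V) (h0 : b x = 0) :
    a x = 0 := by
  by_contra hne
  have ca := (ha.continuousAt (hV.mem_nhds hx)).norm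
  have cb := ((hb.continuousAt (hV.mem_nhds hx)).norm).const_mul M
  have hlt : M * ‖b x‖ < ‖a x‖ := by simp [h0, hne]
  have hev := (cb.eventually_lt ca hlt).and (hV.mem_nhds hx)
  obtain ⟨δ, hδ, hball⟩ := Metric.mem_nhds_iff.1 hev
  obtain ⟨y, hy, hP⟩ := ae_exists_near h x hδ
  have := hball hy
  exact absurd (hP this.2) (not_le.2 this.1)

lemma local_conclusion {n : ℕ} {Ω : Set (Fin n → ℂ)} (hΩ : IsOpen Ω)
    {f : (Fin n → ℂ) → ℂ} (hf : ContinuousOn f Ω)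
    {K : ℝ} (hK : 0 ≤ K) {A : Fin n → (Fin n → ℂ) → ℂ} (hAm : ∀ j, Measurable (A j))
    (hAK : ∀ j z, ‖A j z‖ ≤ K) (hA0 : ∀ j z, f z = 0 → A j z = 0)
    (heq : ∀ j, DbarEqOnC n (Ω \ f ⁻¹' {0}) f (A j) j) :
    IsComplexVarietyIn n {z ∈ Ω | f z = 0} Ω := by
  intro p hp
  obtain ⟨R, hR, hRΩ⟩ := Metric.nhds_basis_closedBall.mem_iff.1 (hΩ.mem_nhds hp)
  have hA : ∀ k, BM (A k) := fun k => ⟨hAm k, K, hAK k⟩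
  have hmono : ∀ {φ : (Fin n → ℂ) → ℂ} {s : ℝ}, s ≤ R → IsTestC n (ball p s) φ → IsTestC n Ω φ :=
    fun hs h => ⟨h.1, h.2.1, h.2.2.trans ((ball_subset_closedBall.trans
      (closedBall_subset_closedBall hs)).trans hRΩ)⟩
  have hWC : WC (ball p R) A := by
    intro φ hφ a b
    have h := weak_two hΩ hf hK hAm hAK hA0 heq (hmono le_rfl hφ) a b
    have hφ1 : ContDiff ℝ 1 φ := hφ.1.of_le (by simp)
    have i1 : ∀ a b, Integrable (fun z => A b z * wd Complex.I φ a z) := fun a b =>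
      (hA b).mul_int (wd_continuous hφ1) (wd_hcs hφ.2.1)
    have e : (fun z => wd Complex.I φ a z * A b z - wd Complex.I φ b z * A a z)
        = fun z => A b z * wd Complex.I φ a z - A a z * wd Complex.I φ b z := by
      ext z; ring
    rw [e, integral_sub (i1 a b) (i1 b a)] at h
    exact sub_eq_zero.1 h
  obtain ⟨R', hR', hR'R, u, hu, hsol⟩ := weak_solve p hR hA hWC
  have hsub : ball p R' ⊆ Ω := (ball_subset_closedBall.trans
      (closedBall_subset_closedBall hR'R)).trans hRΩ
  set F : (Fin n → ℂ) → ℂ := (ball p R').indicator f with hFd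
  have hF : BM F := by
    refine ⟨?_, ?_⟩
    · rw [hFd]
      classical
      rw [← Set.piecewise_eq_indicator]
      exact (hf.mono hsub).measurable_piecewise continuousOn_const isOpen_ball.measurableSet
    · obtain ⟨C, hC⟩ := (isCompact_closedBall p R).exists_bound_of_continuousOn (hf.mono hRΩ)
      have hC0 : 0 ≤ C := (norm_nonneg _).trans (hC p (mem_closedBall_self hR.le))
      refine ⟨C, fun z => ?_⟩
      by_cases hz : z ∈ ball p R'
      · rw [hFd, indicator_of_mem hz]
        exact hC z (closedBall_subset_closedBall hR'R (ball_subset_closedBall hz))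
      · rw [hFd, indicator_of_notMem hz]
        simpa using hC0
  have hF1 : ∀ j, ∀ φ, IsTestC n (ball p R') φ →
      ∫ z, (F z * wd Complex.I φ j z + A j z * F z * φ z) = 0 := by
    intro j φ hφ
    rw [← weak_one hΩ hf hK hAm hAK heq (hmono hR'R hφ) j]
    congr 1
    ext z
    by_cases hz : z ∈ ball p R'
    · rw [hFd, indicator_of_mem hz]
    · have hz' : z ∉ tsupport φ := fun h => hz (hφ.2.2 h)
      rw [wd_support hz', image_eq_zero_of_notMem_tsupport hz']
      simp
  obtain ⟨g, hg, hgae⟩ := weyl hR' (hF.mul hu.exp_neg) (fun φ hφ j =>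
    twist isOpen_ball hF hu (hA j) (hF1 j) (fun φ hφ => hsol φ hφ j) hφ)
  have hsub8 : ball p (R' / 8) ⊆ ball p R' := ball_subset_ball (by linarith)
  obtain ⟨-, C, hC⟩ := hu
  have hfc : ContinuousOn f (ball p (R' / 8)) := hf.mono (hsub8.trans hsub)
  refine ⟨ball p (R' / 8), isOpen_ball, mem_ball_self (by positivity), hsub8.trans hsub, Unit,
    fun _ => g, fun _ => hg, ?_⟩
  ext w
  simp only [mem_inter_iff, mem_ofPred_eq, forall_const]
  constructor
  · rintro ⟨⟨_, h0⟩, hw⟩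
    refine ⟨hw, zero_iff_of_ae isOpen_ball hg.continuousOn hfc (M := Real.exp C) ?_ hw h0⟩
    filter_upwards [hgae] with z hz hzV
    rw [hz hzV, hFd, indicator_of_mem (hsub8 hzV), norm_mul, mul_comm]
    exact mul_le_mul_of_nonneg_right (norm_exp_neg_le (hC z)) (norm_nonneg _)
  · rintro ⟨hw, h0⟩
    refine ⟨⟨hsub (hsub8 hw), zero_iff_of_ae isOpen_ball hfc hg.continuousOn (M := Real.exp C)
      ?_ hw h0⟩, hw⟩
    filter_upwards [hgae] with z hz hzV
    rw [hz hzV, hFd, indicator_of_mem (hsub8 hzV)]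
    have e : f z = Complex.exp (-(-u z)) * (f z * Complex.exp (-u z)) := by
      rw [mul_left_comm, ← Complex.exp_add]; simp
    conv_lhs => rw [e]
    rw [norm_mul]
    exact mul_le_mul_of_nonneg_right (norm_exp_neg_le (by rw [norm_neg]; exact hC z))
      (norm_nonneg _)

/-- **Proposition A.** Let `Ω ⊆ ℂⁿ` be open and `f : Ω → ℂ` continuous. If on
`Ω \ f⁻¹(0)` one has `|∂̄f| ≤ K|f|` for some constant `K > 0`, in the sense that
`∂f/∂z̄_j = A_j f` in the distribution sense on `Ω \ f⁻¹(0)` with `A_j`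
measurable and `|A_j| ≤ K` a.e. there, then `f⁻¹(0)` is a complex analytic set in `Ω`. -/
theorem prop_A (n : ℕ) (Ω : Set (Fin n → ℂ)) (hΩ : IsOpen Ω)
    (f : (Fin n → ℂ) → ℂ) (hf : ContinuousOn f Ω)
    (K : ℝ) (hK : 0 < K) (A : Fin n → (Fin n → ℂ) → ℂ)
    (hAmeas : ∀ j, AEStronglyMeasurable (A j) volume)
    (hAbd : ∀ j, ∀ᵐ z : (Fin n → ℂ), z ∈ Ω \ f ⁻¹' {0} → ‖A j z‖ ≤ K)
    (heq : ∀ j, DbarEqOnC n (Ω \ f ⁻¹' {0}) f (A j) j) :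
    IsComplexVarietyIn n {z ∈ Ω | f z = 0} Ω := by
  have hopen : IsOpen (Ω \ f ⁻¹' {0}) := by
    have := hf.isOpen_inter_preimage hΩ (isOpen_compl_singleton (x := (0:ℂ)))
    rwa [preimage_compl, ← sdiff_eq] at this
  have hmk : ∀ j, Measurable ((hAmeas j).mk (A j)) := fun j =>
    (hAmeas j).stronglyMeasurable_mk.measurable
  set S : Fin n → Set (Fin n → ℂ) := fun j =>
    (Ω \ f ⁻¹' {0}) ∩ {z | ‖(hAmeas j).mk (A j) z‖ ≤ K} with hS
  have hSm : ∀ j, MeasurableSet (S j) := fun j =>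
    hopen.measurableSet.inter (measurableSet_le (hmk j).norm measurable_const)
  refine local_conclusion hΩ hf hK.le (A := fun j => (S j).indicator ((hAmeas j).mk (A j)))
    (fun j => (hmk j).indicator (hSm j)) ?_ ?_ ?_
  · intro j z
    by_cases hz : z ∈ S j
    · rw [indicator_of_mem hz]; exact hz.2
    · rw [indicator_of_notMem hz]; simpa using hK.le
  · intro j z h0
    refine indicator_of_notMem (fun hz => ?_) _
    exact hz.1.2 h0
  · intro j φ hφ
    rw [heq j φ hφ]
    congr 1
    refine setIntegral_congr_ae hopen.measurableSet ?_
    filter_upwards [(hAmeas j).ae_eq_mk, hAbd j] with z hz hzK hzU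
    have : z ∈ S j := ⟨hzU, by
      show ‖_‖ ≤ K
      rw [← hz]; exact hzK hzU⟩
    rw [indicator_of_mem this, ← hz]

end
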